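/- arXiv:2308.08672 — 2 statements merged into one kernel-verified Lean document; each statement's English description precedes it below -/
import Mathlib

section
/- There exist absolute constants c₀ > 0 and L₀ > 0 such that for every L ≥ L₀ and every sample size n the following holds with ε = c₀·n^{−1/5}: for every Borel-measurable test function ψ : ([0,1]³)ⁿ → [0,1], the sum of the worst-case type I and type II errors, sup over p ∈ P₀^W(L) of E_{p⊗n}[ψ] plus sup over p ∈ P₁^W(L,ε) of E_{p⊗n}[1 − ψ], is strictly greater than 1/3. Consequently the critical radius ε_n(P₀^W(L), P₁^W(L,ε)) = inf{ε : R_n(ε) ≤ 1/3} satisfies ε_n ≥ c₀·n^{−1/5}, where R_n(ε) is the minimax testing risk. -/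
open MeasureTheory

noncomputable section

/-- A coupling of `μ` and `ν`: a measure on the product whose marginals are `μ` and `ν`. -/
def IsCoupling {α β : Type*} [MeasurableSpace α] [MeasurableSpace β]
    (γ : Measure (α × β)) (μ : Measure α) (ν : Measure β) : Prop :=
  γ.map Prod.fst = μ ∧ γ.map Prod.snd = ν

/-- The optimal transport cost between `μ` and `ν` for the cost function `cost`. -/
def transportCost {α β : Type*} [MeasurableSpace α] [MeasurableSpace β]
    (cost : α → β → ℝ) (μ : Measure α) (ν : Measure β) : ℝ :=
  sInf {c : ℝ | ∃ γ : Measure (α × β), IsProbabilityMeasure γ ∧ IsCoupling γ μ ν ∧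
    c = ∫ z, cost z.1 z.2 ∂γ}

/-- Euclidean distance on `ℝ²` (represented as `ℝ × ℝ`). -/
def eucDist (x y : ℝ × ℝ) : ℝ := Real.sqrt ((x.1 - y.1) ^ 2 + (x.2 - y.2) ^ 2)

/-- Wasserstein-1 distance on `ℝ²` with Euclidean cost. -/
def W1 (μ ν : Measure (ℝ × ℝ)) : ℝ := transportCost eucDist μ ν

/-- Wasserstein-2 distance on `ℝ²` with Euclidean cost. -/
def W2 (μ ν : Measure (ℝ × ℝ)) : ℝ :=
  Real.sqrt (transportCost (fun x y => (x.1 - y.1) ^ 2 + (x.2 - y.2) ^ 2) μ ν)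

/-- Wasserstein-1 distance on `ℝ` with cost `|x - y|`. -/
def W1R (μ ν : Measure ℝ) : ℝ := transportCost (fun x y => |x - y|) μ ν

/-- Wasserstein-2 distance on `ℝ` with cost `|x - y|`. -/
def W2R (μ ν : Measure ℝ) : ℝ :=
  Real.sqrt (transportCost (fun x y => (x - y) ^ 2) μ ν)

/-- The unit square `[0,1]² ⊆ ℝ²`. -/
def unitSq : Set (ℝ × ℝ) := Set.Icc 0 1 ×ˢ Set.Icc 0 1

/-- The unit interval `[0,1] ⊆ ℝ`. -/
def unitI : Set ℝ := Set.Icc 0 1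

/-- `κ` is a regular conditional distribution (a Markov kernel, supported on `[0,1]²`) of
`(X,Y)` given `Z = z`, for a probability measure `p` on `[0,1]³ ⊆ (ℝ × ℝ) × ℝ` whose first
coordinate is `(X,Y)` and second coordinate is `Z`. -/
def IsCondKernel (p : Measure ((ℝ × ℝ) × ℝ)) (κ : ℝ → Measure (ℝ × ℝ)) : Prop :=
  (∀ z, IsProbabilityMeasure (κ z)) ∧
  (∀ z ∈ unitI, κ z unitSq = 1) ∧
  (∀ A : Set (ℝ × ℝ), MeasurableSet A → Measurable fun z => κ z A) ∧
  (∀ A : Set (ℝ × ℝ), MeasurableSet A → ∀ B : Set ℝ, MeasurableSet B →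
    p (A ×ˢ B) = ∫⁻ z in B, κ z A ∂(p.map Prod.snd))

/-- The product of the two marginals of a measure on `ℝ²`. -/
def prodMargins (μ : Measure (ℝ × ℝ)) : Measure (ℝ × ℝ) :=
  (μ.map Prod.fst).prod (μ.map Prod.snd)

/-- The conditional distribution of `(X,Y)` given `Z ∈ C`, i.e. the normalized mixture
`A ↦ (1 / p_Z(C)) ∫_C κ_z(A) dp_Z(z)`. -/
def condBin (p : Measure ((ℝ × ℝ) × ℝ)) (κ : ℝ → Measure (ℝ × ℝ)) (C : Set ℝ) :
    Measure (ℝ × ℝ) :=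
  (p.map Prod.snd C)⁻¹ • ((p.map Prod.snd).restrict C).bind κ

/-- Wasserstein-1 Lipschitz smoothness of the conditional distributions:
`W1(p_{X,Y|Z=z}, p_{X,Y|Z=z'}) ≤ L·|z - z'|` for all `z, z' ∈ [0,1]`. -/
def WSmooth (L : ℝ) (κ : ℝ → Measure (ℝ × ℝ)) : Prop :=
  ∀ z ∈ unitI, ∀ z' ∈ unitI, W1 (κ z) (κ z') ≤ L * |z - z'|

/-- A Markov kernel from `[0,1]` to Borel probability measures on `[0,1]`. -/
def IsMarkovKernel01 (q : ℝ → Measure ℝ) : Prop :=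
  (∀ z, IsProbabilityMeasure (q z)) ∧
  (∀ z ∈ unitI, q z unitI = 1) ∧
  (∀ B : Set ℝ, MeasurableSet B → Measurable fun z => q z B)

/-- Membership in the null class `P₀^W(L)`: a conditionally independent probability measure
on `[0,1]³` (with regular conditional distribution `κ`) whose conditional distributions are
`W1`-Lipschitz in `z` with constant `L`. -/
def InNullClass (L : ℝ) (p : Measure ((ℝ × ℝ) × ℝ)) (κ : ℝ → Measure (ℝ × ℝ)) : Prop :=
  IsProbabilityMeasure p ∧ p (unitSq ×ˢ unitI) = 1 ∧ IsCondKernel p κ ∧ WSmooth L κ ∧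
    ∀ᵐ z ∂(p.map Prod.snd), κ z = prodMargins (κ z)

/-- Membership in the alternative class `P₁^W(L, ε)`: a non-conditionally-independent
probability measure on `[0,1]³` with `W1`-Lipschitz conditional distributions, whose
expected conditional `W2` distance to every conditionally independent distribution
(equivalently, to every pair of Markov kernels) is at least `ε`. -/
def InAltClass (L ε : ℝ) (p : Measure ((ℝ × ℝ) × ℝ)) (κ : ℝ → Measure (ℝ × ℝ)) : Prop :=
  IsProbabilityMeasure p ∧ p (unitSq ×ˢ unitI) = 1 ∧ IsCondKernel p κ ∧ WSmooth L κ ∧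
    (¬ ∀ᵐ z ∂(p.map Prod.snd), κ z = prodMargins (κ z)) ∧
    ∀ qX qY : ℝ → Measure ℝ, IsMarkovKernel01 qX → IsMarkovKernel01 qY →
      ε ≤ ∫ z, W2 (κ z) ((qX z).prod (qY z)) ∂(p.map Prod.snd)

def sg (b : Bool) : ℝ := if b then 1 else -1

/-- finite core -/
theorem core_finite (m n : ℕ) (hm : 0 < m) (hmn : 32 * (n:ℝ)^2 ≤ (m:ℝ)^5)
    (ψ : (Fin n → Fin m × Bool × Bool) → ℝ) (hψ : ∀ ω, ψ ω ∈ Set.Icc (0:ℝ) 1) :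
    ∃ ν : Fin m → Bool,
      (∑ ω, (∏ i, (1/(m:ℝ) * ((1 + (sg (ν (ω i).1) / m) * sg (ω i).2.2)/4))) * ψ ω) -
      (∑ ω, (∏ i, (1/(m:ℝ) * ((1 + 0 * sg (ω i).2.2)/4))) * ψ ω) < 2/3 := by
  have hm0 : (0:ℝ) < m := by exact_mod_cast hm
  have hm1 : (1:ℝ) ≤ m := by exact_mod_cast hm
  set u : ℝ := 1/(4*(m:ℝ)) with hu
  have hu0 : 0 ≤ u := by positivity
  set l : (Fin m → Bool) → Fin m × Bool × Bool → ℝ := fun ν a => 1 + sg (ν a.1)/m * sg a.2.2 with hl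
  set g : (Fin n → Fin m × Bool × Bool) → ℝ := fun ω => (1/2^m) * ∑ ν, ∏ i, l ν (ω i) with hg
  have e0 : ∀ ω : Fin n → Fin m × Bool × Bool, (∏ i, (1/(m:ℝ) * ((1 + 0 * sg (ω i).2.2)/4))) = u^n := by
    intro ω
    rw [Finset.prod_congr rfl (g := fun _ => u)]
    · simp
    · intro i _; rw [hu]; field_simp; ring
  have e1 : ∀ (ν : Fin m → Bool) (ω : Fin n → Fin m × Bool × Bool),
      (∏ i, (1/(m:ℝ) * ((1 + (sg (ν (ω i).1) / m) * sg (ω i).2.2)/4))) = u^n * ∏ i, l ν (ω i) := by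
    intro ν ω
    have : u^n = ∏ i : Fin n, u := by simp
    rw [this, ← Finset.prod_mul_distrib]
    refine Finset.prod_congr rfl fun i _ => ?_
    rw [hu, hl]; field_simp
  simp only [e0, e1]
  by_contra! hcon
  -- average
  have havg : 2/3 ≤ -∑ ω, u^n * (ψ ω * (1 - g ω)) := by
    have h1 := Finset.sum_le_sum (fun ν (_ : ν ∈ (Finset.univ : Finset (Fin m → Bool))) => hcon ν)
    rw [Finset.sum_const, Finset.sum_sub_distrib, Finset.sum_const, Finset.sum_comm] at h1
    simp only [Finset.card_univ, Fintype.card_pi, Fintype.card_bool, Finset.prod_const, Fintype.card_fin, nsmul_eq_mul] at h1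
    push_cast at h1
    have h2 : ∑ ω, u^n * (ψ ω * (1 - g ω)) = (1/2^m) * (2^m * (∑ ω, u^n * ψ ω) - ∑ ω, ∑ ν, u^n * (∏ i, l ν (ω i)) * ψ ω) := by
      rw [Finset.mul_sum, ← Finset.sum_sub_distrib, Finset.mul_sum]
      refine Finset.sum_congr rfl fun ω _ => ?_
      rw [← Finset.sum_mul, ← Finset.mul_sum, hg]
      field_simp
    rw [h2, ← mul_neg]
    have h3 : (0:ℝ) < 2^m := by positivity
    rw [one_div, ← div_eq_inv_mul, le_div_iff₀ h3]
    linarith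
  have hS : ∑ _ω : Fin n → Fin m × Bool × Bool, u^n = 1 := by
    simp only [Finset.sum_const, Finset.card_univ, Fintype.card_pi, Fintype.card_prod, Fintype.card_bool, Finset.prod_const, Fintype.card_fin, nsmul_eq_mul]
    norm_num only [Nat.cast_mul, Nat.cast_pow, Nat.cast_ofNat]
    rw [← mul_pow, hu]
    have : (m:ℝ) * 4 * (1/(4*(m:ℝ))) = 1 := by field_simp
    rw [this, one_pow]
  have hEl : ∀ ν, ∑ a, u * l ν a = 1 := by
    intro ν
    have h1 : (1:ℝ) = ∑ j : Fin m, 1/(m:ℝ) := by simp; field_simp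
    rw [h1, Fintype.sum_prod_type]
    refine Finset.sum_congr rfl fun j _ => ?_
    simp only [Fintype.sum_prod_type, Fintype.sum_bool, hl, hu]
    have t1 : sg true = 1 := by simp [sg]
    have t2 : sg false = -1 := by simp [sg]
    rw [t1, t2]; field_simp; ring
  have hEg : ∑ ω, u^n * g ω = 1 := by
    have h1 : ∀ ω, u^n * g ω = (1/2^m) * ∑ ν, ∏ i, (u * l ν (ω i)) := by
      intro ω
      simp only [hg, Finset.prod_mul_distrib]
      rw [← Finset.mul_sum]; simp; ring
    simp only [h1]
    rw [← Finset.mul_sum, Finset.sum_comm]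
    have h2 : ∀ ν, ∑ ω : Fin n → Fin m × Bool × Bool, ∏ i, (u * l ν (ω i)) = 1 := by
      intro ν
      have := Finset.prod_univ_sum (fun _ : Fin n => (Finset.univ : Finset (Fin m × Bool × Bool))) (fun _ a => u * l ν a)
      rw [Fintype.piFinset_univ] at this
      rw [← this]; simp [hEl]
    simp [h2]
  have hEll : ∀ ν ν', ∑ a, u * (l ν a * l ν' a) = 1 + ∑ j, (sg (ν j) * sg (ν' j)) / (m:ℝ)^3 := by
    intro ν ν'
    have h1 : (1:ℝ) = ∑ j : Fin m, 1/(m:ℝ) := by simp; field_simp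
    rw [h1, ← Finset.sum_add_distrib, Fintype.sum_prod_type]
    refine Finset.sum_congr rfl fun j _ => ?_
    simp only [Fintype.sum_prod_type, Fintype.sum_bool, hl, hu]
    have t1 : sg true = 1 := by simp [sg]
    have t2 : sg false = -1 := by simp [sg]
    rw [t1, t2]; field_simp; ring
  have hEg2 : ∑ ω, u^n * (g ω)^2 ≤ Real.exp (1/16) := by
    have h1 : ∀ ω, u^n * (g ω)^2 = (1/2^m)^2 * ∑ ν, ∑ ν', ∏ i, (u * (l ν (ω i) * l ν' (ω i))) := by
      intro ω
      simp only [hg, Finset.prod_mul_distrib]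
      rw [mul_pow, sq (∑ ν, _), Finset.sum_mul_sum]
      simp only [← Finset.mul_sum]; simp; ring
    simp only [h1]
    rw [← Finset.mul_sum, Finset.sum_comm]
    have h2 : ∀ ν, ∑ ω : Fin n → Fin m × Bool × Bool, ∑ ν', ∏ i, (u * (l ν (ω i) * l ν' (ω i))) = ∑ ν' : Fin m → Bool, (1 + ∑ j, (sg (ν j) * sg (ν' j)) / (m:ℝ)^3)^n := by
      intro ν
      rw [Finset.sum_comm]
      refine Finset.sum_congr rfl fun ν' _ => ?_
      have := Finset.prod_univ_sum (fun _ : Fin n => (Finset.univ : Finset (Fin m × Bool × Bool))) (fun _ a => u * (l ν a * l ν' a))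
      rw [Fintype.piFinset_univ] at this
      rw [← this]; simp [hEll]
    simp only [h2]
    set a : ℝ := n / (m:ℝ)^3 with ha
    have h3 : ∀ ν ν' : Fin m → Bool, (1 + ∑ j, (sg (ν j) * sg (ν' j)) / (m:ℝ)^3)^n ≤ ∏ j, Real.exp (a * (sg (ν j) * sg (ν' j))) := by
      intro ν ν'
      rw [← Real.exp_sum]
      have hx : 0 ≤ 1 + ∑ j, (sg (ν j) * sg (ν' j)) / (m:ℝ)^3 := by
        rw [← hEll]
        refine Finset.sum_nonneg fun b _ => mul_nonneg hu0 ?_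
        have hl0 : ∀ ν, 0 ≤ l ν b := by
          intro ν
          have : (1:ℝ)/m ≤ 1 := by rw [div_le_one hm0]; exact hm1
          have h0 : (0:ℝ) ≤ 1/m := by positivity
          simp only [hl, sg]
          split_ifs <;> (try simp only [neg_div]) <;> linarith
        exact mul_nonneg (hl0 _) (hl0 _)
      calc _ ≤ (Real.exp (∑ j, (sg (ν j) * sg (ν' j)) / (m:ℝ)^3))^n := by
            refine pow_le_pow_left₀ hx ?_ n
            have := Real.add_one_le_exp (∑ j, (sg (ν j) * sg (ν' j)) / (m:ℝ)^3)
            linarith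
        _ = _ := by
            rw [← Real.exp_nat_mul]
            congr 1
            rw [Finset.mul_sum]
            refine Finset.sum_congr rfl fun j _ => ?_
            rw [ha]; ring
    have h4 : ∑ ν : Fin m → Bool, ∑ ν' : Fin m → Bool, ∏ j, Real.exp (a * (sg (ν j) * sg (ν' j))) = (4 * Real.cosh a)^m := by
      have h5 : ∀ ν : Fin m → Bool, ∑ ν' : Fin m → Bool, ∏ j, Real.exp (a * (sg (ν j) * sg (ν' j))) = (2 * Real.cosh a)^m := by
        intro ν
        have := Finset.prod_univ_sum (fun _ : Fin m => (Finset.univ : Finset Bool)) (fun j b => Real.exp (a * (sg (ν j) * sg b)))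
        rw [Fintype.piFinset_univ] at this
        rw [← this]
        have h6 : ∀ j, ∑ b, Real.exp (a * (sg (ν j) * sg b)) = 2 * Real.cosh a := by
          intro j
          rw [Real.cosh_eq]
          cases ν j <;> simp [sg] <;> ring
        simp only [h6]; simp
      simp only [h5]
      simp [← mul_pow]; ring
    have h7 : ∑ ν : Fin m → Bool, ∑ ν' : Fin m → Bool, (1 + ∑ j, (sg (ν j) * sg (ν' j)) / (m:ℝ)^3)^n ≤ (4 * Real.cosh a)^m := by
      rw [← h4]
      exact Finset.sum_le_sum fun ν _ => Finset.sum_le_sum fun ν' _ => h3 ν ν'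
    calc _ ≤ (1/2^m)^2 * (4 * Real.cosh a)^m := by gcongr
      _ = (Real.cosh a)^m := by
          rw [mul_pow]
          have : ((4:ℝ))^m = (2^m)^2 := by rw [← pow_mul, mul_comm, pow_mul]; norm_num
          rw [this]; field_simp
      _ ≤ (Real.exp (a^2/2))^m := by
          refine pow_le_pow_left₀ (Real.cosh_pos a).le (Real.cosh_le_exp_half_sq a) m
      _ ≤ _ := by
          rw [← Real.exp_nat_mul]
          apply Real.exp_le_exp.2
          rw [ha]
          have : (m:ℝ) * ((n/(m:ℝ)^3)^2/2) = n^2/(2 * (m:ℝ)^5) := by field_simp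
          rw [this, div_le_iff₀ (by positivity)]
          have := sq_nonneg (n:ℝ)
          linarith
  have hcs := Finset.sum_mul_sq_le_sq_mul_sq Finset.univ (fun ω => Real.sqrt (u^n) * ψ ω) (fun ω => Real.sqrt (u^n) * (1 - g ω))
  have hs : Real.sqrt (u^n) * Real.sqrt (u^n) = u^n := Real.mul_self_sqrt (by positivity)
  have c1 : ∑ ω, (Real.sqrt (u^n) * ψ ω) * (Real.sqrt (u^n) * (1 - g ω)) = ∑ ω, u^n * (ψ ω * (1 - g ω)) := by
    refine Finset.sum_congr rfl fun ω _ => ?_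
    linear_combination (ψ ω * (1 - g ω)) * hs
  have c2 : ∑ ω, (Real.sqrt (u^n) * ψ ω)^2 ≤ 1 := by
    rw [← hS]
    refine Finset.sum_le_sum fun ω _ => ?_
    rw [mul_pow, sq (Real.sqrt _), hs]
    have := hψ ω
    have h2 : ψ ω ^2 ≤ 1 := by nlinarith [this.1, this.2]
    exact mul_le_of_le_one_right (by positivity) h2
  have c3 : ∑ ω, (Real.sqrt (u^n) * (1 - g ω))^2 = 1 - 2 * 1 + ∑ ω, u^n * (g ω)^2 := by
    have : (1:ℝ) - 2 * 1 = (∑ _ω : Fin n → Fin m × Bool × Bool, u^n) - 2 * ∑ ω, u^n * g ω := by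
      rw [hS, hEg]
    rw [this, Finset.mul_sum, ← Finset.sum_sub_distrib, ← Finset.sum_add_distrib]
    refine Finset.sum_congr rfl fun ω _ => ?_
    rw [mul_pow, sq (Real.sqrt _), hs]; ring
  have c4 : Real.exp (1/16) < 1 + 4/9 := by
    have := Real.exp_one_lt_d9
    have h : Real.exp (1/16) ^ 16 < (1 + 4/9)^16 := by
      rw [← Real.exp_nat_mul]; norm_num at *; linarith
    exact lt_of_pow_lt_pow_left₀ 16 (by norm_num) h
  rw [c1, c3] at hcs
  have c5 : (0:ℝ) ≤ 1 - 2 * 1 + ∑ ω, u^n * (g ω)^2 := by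
    rw [← c3]; positivity
  nlinarith

def bb (b : Bool) : ℝ := if b then 1 else 0

def pt (x s : Bool) : ℝ × ℝ := (bb x, bb (x == s))

def zf (m : ℕ) (j : Fin m) : ℝ := (j : ℝ) / m

def KK (a : ℝ) : Measure (ℝ × ℝ) :=
  ∑ x : Bool, ∑ s : Bool, ENNReal.ofReal ((1 + a * sg s)/4) • Measure.dirac (pt x s)

def PZ (m : ℕ) : Measure ℝ := ∑ j : Fin m, ENNReal.ofReal (1/(m:ℝ)) • Measure.dirac (zf m j)

def TT (m : ℕ) (a : Fin m × Bool × Bool) : (ℝ × ℝ) × ℝ := (pt a.2.1 a.2.2, zf m a.1)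

def ww (m : ℕ) (η : ℝ → ℝ) (a : Fin m × Bool × Bool) : ℝ :=
  1/(m:ℝ) * ((1 + η (zf m a.1) * sg a.2.2)/4)

def PP (m : ℕ) (η : ℝ → ℝ) : Measure ((ℝ × ℝ) × ℝ) :=
  ∑ a, ENNReal.ofReal (ww m η a) • Measure.dirac (TT m a)

theorem sg_abs (s : Bool) : |sg s| = 1 := by cases s <;> simp [sg]

theorem wt_nonneg {a : ℝ} (ha : |a| ≤ 1) (s : Bool) : 0 ≤ (1 + a * sg s)/4 := by
  have := abs_le.1 ha
  cases s <;> simp [sg] <;> linarith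

theorem ww_nonneg (m : ℕ) {η : ℝ → ℝ} (h : ∀ z, |η z| ≤ 1) (a) : 0 ≤ ww m η a :=
  mul_nonneg (by positivity) (wt_nonneg (h _) _)

theorem zf_mem (m : ℕ) (j : Fin m) : zf m j ∈ unitI := by
  have : (0:ℝ) < m := by exact_mod_cast (Nat.pos_of_ne_zero (by rintro rfl; exact j.elim0))
  refine ⟨by unfold zf; positivity, ?_⟩
  unfold zf
  rw [div_le_one this]
  exact_mod_cast j.2.le

theorem pt_mem (x s : Bool) : pt x s ∈ unitSq := by
  cases x <;> cases s <;> simp [pt, bb, unitSq]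

theorem KK_apply (a : ℝ) (A : Set (ℝ × ℝ)) :
    KK a A = ∑ x : Bool, ∑ s : Bool, ENNReal.ofReal ((1 + a * sg s)/4) * A.indicator 1 (pt x s) := by
  simp [KK]

theorem PP_apply (m : ℕ) (η) (A : Set ((ℝ × ℝ) × ℝ)) :
    PP m η A = ∑ a, ENNReal.ofReal (ww m η a) * A.indicator 1 (TT m a) := by
  simp [PP]

theorem PZ_apply (m : ℕ) (A : Set ℝ) :
    PZ m A = ∑ j, ENNReal.ofReal (1/(m:ℝ)) * A.indicator 1 (zf m j) := by
  simp [PZ]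

theorem KK_one_of {a : ℝ} (ha : |a| ≤ 1) {A : Set (ℝ × ℝ)} (h : ∀ x s, pt x s ∈ A) :
    KK a A = 1 := by
  rw [KK_apply]
  simp only [Set.indicator_of_mem (h _ _), Pi.one_apply, mul_one]
  simp only [Fintype.sum_bool]
  have := wt_nonneg ha
  rw [← ENNReal.ofReal_add (this _) (this _), ← ENNReal.ofReal_add (add_nonneg (this _) (this _)) (add_nonneg (this _) (this _))]
  rw [← ENNReal.ofReal_one]; congr 1; simp [sg]; ring

theorem PP_prod (m : ℕ) {η} (A : Set (ℝ × ℝ)) (B : Set ℝ) :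
    PP m η (A ×ˢ B) = ∑ j, ENNReal.ofReal (1/(m:ℝ)) * (B.indicator 1 (zf m j) * KK (η (zf m j)) A) := by
  rw [PP_apply, Fintype.sum_prod_type]
  refine Finset.sum_congr rfl fun j _ => ?_
  rw [Fintype.sum_prod_type, KK_apply, Finset.mul_sum, Finset.mul_sum]
  refine Finset.sum_congr rfl fun x _ => ?_
  rw [Finset.mul_sum, Finset.mul_sum]
  refine Finset.sum_congr rfl fun s _ => ?_
  simp only [ww, TT]
  rw [ENNReal.ofReal_mul (by positivity)]
  by_cases h1 : pt x s ∈ A <;> by_cases h2 : zf m j ∈ B <;> simp [h1, h2]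

theorem PP_snd (m : ℕ) {η : ℝ → ℝ} (h : ∀ z, |η z| ≤ 1) : (PP m η).map Prod.snd = PZ m := by
  ext B hB
  rw [Measure.map_apply measurable_snd hB]
  have : (Prod.snd ⁻¹' B : Set ((ℝ×ℝ)×ℝ)) = Set.univ ×ˢ B := by ext; simp
  rw [this, PP_prod, PZ_apply]
  refine Finset.sum_congr rfl fun j _ => ?_
  rw [KK_one_of (h _) (by simp), mul_one]

theorem lint_PZ (m : ℕ) (f : ℝ → ENNReal) :
    ∫⁻ z, f z ∂(PZ m) = ∑ j, ENNReal.ofReal (1/(m:ℝ)) * f (zf m j) := by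
  simp [PZ, lintegral_finsetSum_measure]

theorem ae_PZ {m : ℕ} {p : ℝ → Prop} (hm : 0 < m) : (∀ᵐ z ∂(PZ m), p z) ↔ ∀ j, p (zf m j) := by
  rw [ae_iff, PZ_apply, Finset.sum_eq_zero_iff]
  have : ENNReal.ofReal (1/(m:ℝ)) ≠ 0 := by
    simp; omega
  simp only [Finset.mem_univ, true_imp_iff, mul_eq_zero, this, false_or]
  refine forall_congr' fun j => ?_
  by_cases h : p (zf m j) <;> simp [h]

theorem PP_one (m : ℕ) (hm : 0 < m) {η : ℝ → ℝ} (h : ∀ z, |η z| ≤ 1) {A : Set (ℝ × ℝ)} {B : Set ℝ}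
    (hA : ∀ x s, pt x s ∈ A) (hB : ∀ j, zf m j ∈ B) : PP m η (A ×ˢ B) = 1 := by
  rw [PP_prod]
  have hm0 : (0:ℝ) < m := by exact_mod_cast hm
  simp only [KK_one_of (h _) hA, Set.indicator_of_mem (hB _)]
  simp [ENNReal.ofReal_inv_of_pos hm0]
  exact ENNReal.mul_inv_cancel (by simp; omega) (by simp)

theorem PP_prob (m : ℕ) (hm : 0 < m) {η : ℝ → ℝ} (h : ∀ z, |η z| ≤ 1) : IsProbabilityMeasure (PP m η) :=
  ⟨by rw [← Set.univ_prod_univ]; exact PP_one m hm h (by simp) (by simp)⟩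

theorem KK_prob {a : ℝ} (h : |a| ≤ 1) : IsProbabilityMeasure (KK a) :=
  ⟨KK_one_of h (by simp)⟩

theorem cond_PP (m : ℕ) {η : ℝ → ℝ} (h : ∀ z, |η z| ≤ 1) (hη : Measurable η) :
    IsCondKernel (PP m η) (fun z => KK (η z)) := by
  have hmeas : ∀ A : Set (ℝ × ℝ), MeasurableSet A → Measurable fun z => KK (η z) A := by
    intro A _
    simp only [KK_apply]
    fun_prop
  refine ⟨fun z => KK_prob (h z), fun z _ => KK_one_of (h z) pt_mem, hmeas, ?_⟩
  intro A hA B hB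
  rw [PP_snd m h, PP_prod, ← lintegral_indicator hB, lint_PZ]
  refine Finset.sum_congr rfl fun j _ => ?_
  by_cases h2 : zf m j ∈ B <;> simp [h2]

theorem KK_zero : KK 0 = prodMargins (KK 0) := by
  set μ : Measure ℝ := ∑ x : Bool, ENNReal.ofReal (1/2) • Measure.dirac (bb x) with hμ
  have hμa : ∀ A, μ A = ∑ x : Bool, ENNReal.ofReal (1/2) * A.indicator 1 (bb x) := by
    intro A; simp [hμ]
  have : IsProbabilityMeasure μ := ⟨by
    rw [hμa]; simp
    exact ENNReal.mul_inv_cancel (by simp) (by simp)⟩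
  have hK : KK 0 = μ.prod μ := by
    symm
    refine Measure.prod_eq fun s t _ _ => ?_
    rw [KK_apply, hμa, hμa]
    have h4 : ENNReal.ofReal (1/4) = ENNReal.ofReal (1/2) * ENNReal.ofReal (1/2) := by
      rw [← ENNReal.ofReal_mul (by norm_num)]; norm_num
    simp only [Fintype.sum_bool, zero_mul, add_zero, h4, pt]
    by_cases h1 : (1:ℝ) ∈ s <;> by_cases h2 : (0:ℝ) ∈ s <;> by_cases h3 : (1:ℝ) ∈ t <;> by_cases h4 : (0:ℝ) ∈ t <;>
      simp [bb, h1, h2, h3, h4] <;> ring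
  rw [hK, prodMargins]
  simp [Measure.map_fst_prod, Measure.map_snd_prod]

theorem pi_PP (m n : ℕ) (hm : 0 < m) {η : ℝ → ℝ} (h : ∀ z, |η z| ≤ 1) :
    (Measure.pi fun _ : Fin n => PP m η) =
      ∑ ω : Fin n → Fin m × Bool × Bool, ENNReal.ofReal (∏ i, ww m η (ω i)) •
        Measure.dirac (fun i => TT m (ω i)) := by
  have := PP_prob m hm h
  symm
  symm
  refine Measure.pi_eq fun s hs => ?_
  have h1 := Finset.prod_univ_sum (fun _ : Fin n => (Finset.univ : Finset (Fin m × Bool × Bool)))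
    (fun i a => ENNReal.ofReal (ww m η a) * (s i).indicator (1 : (ℝ×ℝ)×ℝ → ENNReal) (TT m a))
  rw [Fintype.piFinset_univ] at h1
  simp only [PP_apply]
  rw [h1]
  simp only [Measure.finsetSum_apply, Measure.smul_apply, smul_eq_mul]
  refine Finset.sum_congr rfl fun ω _ => ?_
  rw [Finset.prod_mul_distrib, ENNReal.ofReal_prod_of_nonneg (fun i _ => ww_nonneg m h _),
    Measure.dirac_apply' _ (MeasurableSet.univ_pi hs)]
  congr 1
  by_cases hh : ∀ i, TT m (ω i) ∈ s i
  · simp [hh]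
  · obtain ⟨i, hi⟩ := not_forall.1 hh
    rw [Finset.prod_eq_zero (Finset.mem_univ i) (by simp [hi])]
    simp [hh]

theorem int_pi_PP (m n : ℕ) (hm : 0 < m) {η : ℝ → ℝ} (h : ∀ z, |η z| ≤ 1)
    (ψ : (Fin n → (ℝ × ℝ) × ℝ) → ℝ) :
    ∫ ω, ψ ω ∂(Measure.pi fun _ : Fin n => PP m η) =
      ∑ ω : Fin n → Fin m × Bool × Bool, (∏ i, ww m η (ω i)) * ψ (fun i => TT m (ω i)) := by
  rw [pi_PP m n hm h, integral_finsetSum_measure]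
  · refine Finset.sum_congr rfl fun ω _ => ?_
    rw [integral_smul_measure, integral_dirac, ENNReal.toReal_ofReal (Finset.prod_nonneg fun i _ => ww_nonneg m h _)]
    rfl
  · intro ω _
    exact (integrable_dirac (by simp)).smul_measure (by simp)

theorem int_PZ (m : ℕ) (f : ℝ → ℝ) :
    ∫ z, f z ∂(PZ m) = ∑ j, (1/(m:ℝ)) * f (zf m j) := by
  rw [PZ, integral_finsetSum_measure]
  · refine Finset.sum_congr rfl fun ω _ => ?_
    rw [integral_smul_measure, integral_dirac, ENNReal.toReal_ofReal (by positivity)]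
    rfl
  · intro ω _
    exact (integrable_dirac (by simp)).smul_measure (by simp)

theorem W1_KK {a b : ℝ} (ha : |a| ≤ 1) (hb : |b| ≤ 1) : W1 (KK a) (KK b) ≤ |a - b| / 2 := by
  set mn := min a b with hmn
  have ha' := abs_le.1 ha
  have hb' := abs_le.1 hb
  have m1 : mn ≤ a := min_le_left _ _
  have m2 : mn ≤ b := min_le_right _ _
  have m3 : -1 ≤ mn := le_min ha'.1 hb'.1
  have m4 : a + b - mn ≤ 1 := by
    rcases min_choice a b with h | h <;> rw [hmn, h] <;> linarith
  have m5 : |a - b| = a + b - 2 * mn := by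
    rcases le_total a b with h | h
    · rw [hmn, min_eq_left h, abs_of_nonpos (by linarith)]; ring
    · rw [hmn, min_eq_right h, abs_of_nonneg (by linarith)]; ring
  set γ : Measure ((ℝ × ℝ) × (ℝ × ℝ)) := ∑ x : Bool,
    (ENNReal.ofReal ((1+mn)/4) • Measure.dirac (pt x true, pt x true)
    + ENNReal.ofReal ((a-mn)/4) • Measure.dirac (pt x true, pt x false)
    + ENNReal.ofReal ((b-mn)/4) • Measure.dirac (pt x false, pt x true)
    + ENNReal.ofReal ((1-(a+b-mn))/4) • Measure.dirac (pt x false, pt x false)) with hγ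
  have hγa : ∀ A, γ A = ∑ x : Bool, (ENNReal.ofReal ((1+mn)/4) * A.indicator 1 (pt x true, pt x true)
    + ENNReal.ofReal ((a-mn)/4) * A.indicator 1 (pt x true, pt x false)
    + ENNReal.ofReal ((b-mn)/4) * A.indicator 1 (pt x false, pt x true)
    + ENNReal.ofReal ((1-(a+b-mn))/4) * A.indicator 1 (pt x false, pt x false)) := by
    intro A; simp [hγ]
  have f1 : γ.map Prod.fst = KK a := by
    ext B hB
    rw [Measure.map_apply measurable_fst hB, hγa, KK_apply]
    refine Finset.sum_congr rfl fun x _ => ?_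
    rw [Fintype.sum_bool]
    have e1 : (1 + a * sg true)/4 = (1+mn)/4 + (a-mn)/4 := by simp [sg]; ring
    have e2 : (1 + a * sg false)/4 = (b-mn)/4 + (1-(a+b-mn))/4 := by simp [sg]; ring
    rw [e1, e2, ENNReal.ofReal_add (by linarith) (by linarith), ENNReal.ofReal_add (by linarith) (by linarith)]
    have : ∀ u v : ℝ × ℝ, (Prod.fst ⁻¹' B).indicator (1 : (ℝ×ℝ)×(ℝ×ℝ) → ENNReal) (u, v) = B.indicator 1 u := by
      intro u v; by_cases h : u ∈ B <;> simp [h]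
    simp only [this]; ring
  have f2 : γ.map Prod.snd = KK b := by
    ext B hB
    rw [Measure.map_apply measurable_snd hB, hγa, KK_apply]
    refine Finset.sum_congr rfl fun x _ => ?_
    rw [Fintype.sum_bool]
    have e1 : (1 + b * sg true)/4 = (1+mn)/4 + (b-mn)/4 := by simp [sg]; ring
    have e2 : (1 + b * sg false)/4 = (a-mn)/4 + (1-(a+b-mn))/4 := by simp [sg]; ring
    rw [e1, e2, ENNReal.ofReal_add (by linarith) (by linarith), ENNReal.ofReal_add (by linarith) (by linarith)]
    have : ∀ u v : ℝ × ℝ, (Prod.snd ⁻¹' B).indicator (1 : (ℝ×ℝ)×(ℝ×ℝ) → ENNReal) (u, v) = B.indicator 1 v := by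
      intro u v; by_cases h : v ∈ B <;> simp [h]
    simp only [this]; ring
  have hp : IsProbabilityMeasure γ := by
    have := KK_prob ha
    rw [← f1] at this
    exact ⟨by simpa [Measure.map_apply measurable_fst MeasurableSet.univ] using this.measure_univ⟩
  have hint : ∫ z, eucDist z.1 z.2 ∂γ = |a - b| / 2 := by
    have hi : ∀ (c : ℝ) (w : (ℝ×ℝ)×(ℝ×ℝ)), Integrable (fun z : (ℝ×ℝ)×(ℝ×ℝ) => eucDist z.1 z.2) (ENNReal.ofReal c • Measure.dirac w) :=
      fun c w => (integrable_dirac (by simp)).smul_measure (by simp)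
    have hI : ∀ (c : ℝ) (w : (ℝ×ℝ)×(ℝ×ℝ)), 0 ≤ c → ∫ z, eucDist z.1 z.2 ∂(ENNReal.ofReal c • Measure.dirac w) = c * eucDist w.1 w.2 := by
      intro c w hc
      rw [integral_smul_measure, integral_dirac, ENNReal.toReal_ofReal hc]; rfl
    rw [hγ, integral_finsetSum_measure]
    swap
    · intro x _
      exact (((hi _ _).add_measure (hi _ _)).add_measure (hi _ _)).add_measure (hi _ _)
    have hx : ∀ x : Bool, ∫ z, eucDist z.1 z.2 ∂(ENNReal.ofReal ((1+mn)/4) • Measure.dirac (pt x true, pt x true)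
    + ENNReal.ofReal ((a-mn)/4) • Measure.dirac (pt x true, pt x false)
    + ENNReal.ofReal ((b-mn)/4) • Measure.dirac (pt x false, pt x true)
    + ENNReal.ofReal ((1-(a+b-mn))/4) • Measure.dirac (pt x false, pt x false)) = |a - b|/4 := by
      intro x
      rw [integral_add_measure (((hi _ _).add_measure (hi _ _)).add_measure (hi _ _)) (hi _ _),
        integral_add_measure ((hi _ _).add_measure (hi _ _)) (hi _ _),
        integral_add_measure (hi _ _) (hi _ _), hI _ _ (by linarith), hI _ _ (by linarith), hI _ _ (by linarith), hI _ _ (by linarith), m5]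
      cases x <;> simp [eucDist, pt, bb] <;> ring
    simp only [hx]
    simp; ring
  rw [W1, transportCost, ← hint]
  refine csInf_le ⟨0, ?_⟩ ⟨γ, hp, ⟨f1, f2⟩, rfl⟩
  rintro c ⟨γ', _, _, rfl⟩
  exact integral_nonneg fun z => Real.sqrt_nonneg _

def HH (x : Bool) : Set ℝ := {t | if x then 1/2 < t else t ≤ 1/2}

theorem HH_meas (x : Bool) : MeasurableSet (HH x) := by
  cases x
  · have : HH false = Set.Iic (1/2 : ℝ) := by ext t; simp [HH]
    rw [this]; exact measurableSet_Iic
  · have : HH true = Set.Ioi (1/2 : ℝ) := by ext t; simp [HH]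
    rw [this]; exact measurableSet_Ioi

theorem KK_HH {a : ℝ} (ha : |a| ≤ 1) (x s : Bool) :
    (KK a).real (HH x ×ˢ HH (x == s)) = (1 + a * sg s)/4 := by
  rw [measureReal_def, KK_apply, ← ENNReal.toReal_ofReal (wt_nonneg ha s)]
  congr 1
  cases x <;> cases s <;> simp [pt, HH, bb] <;> norm_num

theorem prod_HH (q q' : Measure ℝ) [IsProbabilityMeasure q] [IsProbabilityMeasure q'] (x y : Bool) :
    (q.prod q').real (HH x ×ˢ HH y) = (if x then q.real (HH true) else 1 - q.real (HH true)) *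
      (if y then q'.real (HH true) else 1 - q'.real (HH true)) := by
  have h : ∀ (r : Measure ℝ) [IsProbabilityMeasure r], r.real (HH false) = 1 - r.real (HH true) := by
    intro r _
    have : HH false = (HH true)ᶜ := by ext t; simp [HH]
    rw [this, measureReal_compl (HH_meas _)]; simp
  rw [measureReal_prod_prod]
  cases x <;> cases y <;> simp [h]

theorem alg_HH {a t : ℝ} (ha : |a| ≤ 1) (q q' : Measure ℝ) [IsProbabilityMeasure q] [IsProbabilityMeasure q']
    (h : ∀ x y, |(KK a).real (HH x ×ˢ HH y) - (q.prod q').real (HH x ×ˢ HH y)| ≤ t) : |a| ≤ 16 * t := by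
  have h00 := h false false
  have h01 := h false true
  have h10 := h true false
  have h11 := h true true
  have e00 := KK_HH ha false true
  have e01 := KK_HH ha false false
  have e10 := KK_HH ha true false
  have e11 := KK_HH ha true true
  simp only [prod_HH, sg, Bool.false_eq_true, if_true, if_false] at *
  simp only [beq_self_eq_true, (by decide : (false == true) = false), (by decide : (true == false) = false)] at *
  rw [e00] at h00
  rw [e01] at h01
  rw [e10] at h10
  rw [e11] at h11
  have u0 : 0 ≤ q.real (HH true) := measureReal_nonneg
  have u1 : q.real (HH true) ≤ 1 := measureReal_le_one
  have v0 : 0 ≤ q'.real (HH true) := measureReal_nonneg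
  have v1 : q'.real (HH true) ≤ 1 := measureReal_le_one
  generalize q.real (HH true) = u at *
  generalize q'.real (HH true) = v at *
  have ha' := abs_le.1 ha
  have t0 : 0 ≤ t := le_trans (abs_nonneg _) h00
  rw [abs_le] at h00 h01 h10 h11
  obtain ⟨A, hA⟩ : ∃ A, A = (1 + a * 1)/4 := ⟨_, rfl⟩
  obtain ⟨B, hB⟩ : ∃ B, B = (1 + a * -1)/4 := ⟨_, rfl⟩
  rw [← hA] at h00 h11
  rw [← hB] at h01 h10
  have A0 : 0 ≤ A := by rw [hA]; linarith
  have B0 : 0 ≤ B := by rw [hB]; linarith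
  obtain ⟨e, he⟩ : ∃ e, e = (1-u)*(1-v) := ⟨_, rfl⟩
  obtain ⟨f, hf⟩ : ∃ f, f = (1-u)*v := ⟨_, rfl⟩
  obtain ⟨d, hd⟩ : ∃ d, d = u*v := ⟨_, rfl⟩
  obtain ⟨g, hg⟩ : ∃ g, g = u*(1-v) := ⟨_, rfl⟩
  have e0 : 0 ≤ e := by rw [he]; exact mul_nonneg (by linarith) (by linarith)
  have f0 : 0 ≤ f := by rw [hf]; exact mul_nonneg (by linarith) (by linarith)
  have ef : e + f ≤ 1 := by rw [he, hf]; linarith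
  have hdet : d * e = f * g := by rw [hd, he, hf, hg]; ring
  have hAB : A * A - B * B = a / 4 := by rw [hA, hB]; ring
  have hAB' : A + B = 1/2 := by rw [hA, hB]; ring
  rw [← he] at h00
  rw [← hf] at h01
  rw [← hd] at h11
  rw [← hg] at h10
  have p1 := mul_le_mul_of_nonneg_left h00.1 A0
  have p2 := mul_le_mul_of_nonneg_left h00.2 A0
  have p3 := mul_le_mul_of_nonneg_left h11.1 e0
  have p4 := mul_le_mul_of_nonneg_left h11.2 e0
  have p5 := mul_le_mul_of_nonneg_left h01.1 B0
  have p6 := mul_le_mul_of_nonneg_left h01.2 B0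
  have p7 := mul_le_mul_of_nonneg_left h10.1 f0
  have p8 := mul_le_mul_of_nonneg_left h10.2 f0
  have q1 := mul_le_mul_of_nonneg_right ef t0
  have q2 : A * t + B * t = 1/2 * t := by rw [← add_mul, hAB']
  rw [abs_le]
  constructor <;> linarith

theorem W2_KK {a : ℝ} (ha : |a| ≤ 1) (q q' : Measure ℝ) [IsProbabilityMeasure q] [IsProbabilityMeasure q']
    (hq : q unitI = 1) (hq' : q' unitI = 1) : Real.sqrt |a| / 8 ≤ W2 (KK a) (q.prod q') := by
  have hK := KK_prob ha
  have key : |a| / 64 ≤ transportCost (fun x y : ℝ × ℝ => (x.1 - y.1) ^ 2 + (x.2 - y.2) ^ 2) (KK a) (q.prod q') := by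
    refine le_csInf ⟨_, (KK a).prod (q.prod q'), inferInstance, ⟨by simp, by simp⟩, rfl⟩ ?_
    rintro c ⟨γ, hγ, ⟨g1, g2⟩, rfl⟩
    set cost : (ℝ × ℝ) × (ℝ × ℝ) → ℝ := fun z => (z.1.1 - z.2.1) ^ 2 + (z.1.2 - z.2.2) ^ 2 with hcost
    have hcm : Measurable cost := by fun_prop
    set C : Set (ℝ × ℝ) := {w | ∃ x s, w = pt x s} with hC
    have hCf : C.Finite := by
      have : C = Set.range (fun p : Bool × Bool => pt p.1 p.2) := by
        ext w; simp [hC, eq_comm]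
      rw [this]; exact Set.finite_range _
    have ae1 : ∀ᵐ z ∂γ, z.1 ∈ C := by
      have : ∀ᵐ w ∂(KK a), w ∈ C := by
        exact (mem_ae_iff_prob_eq_one hCf.measurableSet).2 (KK_one_of ha fun x s => ⟨x, s, rfl⟩)
      rw [← g1] at this
      exact ae_of_ae_map measurable_fst.aemeasurable this
    have hU : MeasurableSet unitSq := measurableSet_Icc.prod measurableSet_Icc
    have ae2 : ∀ᵐ z ∂γ, z.2 ∈ unitSq := by
      have : ∀ᵐ w ∂(q.prod q'), w ∈ unitSq := by
        refine (mem_ae_iff_prob_eq_one hU).2 ?_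
        have h1 : q (Set.Icc 0 1) = 1 := hq
        have h2 : q' (Set.Icc 0 1) = 1 := hq'
        rw [unitSq, Measure.prod_prod, h1, h2, one_mul]
      rw [← g2] at this
      exact ae_of_ae_map measurable_snd.aemeasurable this
    have hint : Integrable cost γ := by
      refine Integrable.of_bound hcm.aestronglyMeasurable 2 ?_
      filter_upwards [ae1, ae2] with z h1 h2
      obtain ⟨x, s, h1⟩ := h1
      have h3 := pt_mem x s
      rw [← h1] at h3
      obtain ⟨⟨a1, a2⟩, a3, a4⟩ := h3
      obtain ⟨⟨b1, b2⟩, b3, b4⟩ := h2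
      rw [Real.norm_of_nonneg (by simp only [hcost]; positivity)]
      simp only [hcost]
      nlinarith
    set E : Set ((ℝ × ℝ) × (ℝ × ℝ)) := {z | 1/4 ≤ cost z} with hE
    have hEm : MeasurableSet E := measurableSet_le measurable_const hcm
    have hmk : (1/4) * γ.real E ≤ ∫ z, cost z ∂γ :=
      mul_meas_ge_le_integral_of_nonneg (ae_of_all _ fun z => by simp only [hcost]; positivity) hint _
    have hside : ∀ z : (ℝ × ℝ) × (ℝ × ℝ), z.1 ∈ C → z ∉ E → ∀ x y, (z.1 ∈ HH x ×ˢ HH y ↔ z.2 ∈ HH x ×ˢ HH y) := by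
      rintro ⟨⟨z1, z2⟩, ⟨w1, w2⟩⟩ ⟨x', s, h1⟩ h2 x y
      simp only [hE, hcost, Set.mem_ofPred_eq, not_le] at h2
      simp only [pt, Prod.mk.injEq] at h1
      have c1 : ∀ x : Bool, z1 ∈ HH x ↔ w1 ∈ HH x := by
        have : |z1 - w1| < 1/2 := by apply abs_lt_of_sq_lt_sq <;> nlinarith [sq_nonneg (z2 - w2)]
        rw [abs_lt] at this
        intro x
        rcases Bool.eq_false_or_eq_true x' with h | h <;> simp [h, bb] at h1 <;>
          cases x <;> simp [HH, h1.1] <;> (try constructor) <;> (try intro _) <;> linarith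
      have c2 : ∀ x : Bool, z2 ∈ HH x ↔ w2 ∈ HH x := by
        have : |z2 - w2| < 1/2 := by apply abs_lt_of_sq_lt_sq <;> nlinarith [sq_nonneg (z1 - w1)]
        rw [abs_lt] at this
        intro x
        rcases Bool.eq_false_or_eq_true (x' == s) with h | h <;> simp [h, bb] at h1 <;>
          cases x <;> simp [HH, h1.2] <;> (try constructor) <;> (try intro _) <;> linarith
      simp only [Set.mem_prod, c1, c2]
    have hA : ∀ x y, |(KK a).real (HH x ×ˢ HH y) - (q.prod q').real (HH x ×ˢ HH y)| ≤ γ.real E := by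
      intro x y
      have hm := (HH_meas x).prod (HH_meas y)
      rw [← g1, ← g2, map_measureReal_apply measurable_fst hm, map_measureReal_apply measurable_snd hm, abs_le]
      have i1 : γ.real (Prod.fst ⁻¹' (HH x ×ˢ HH y)) ≤ γ.real (Prod.snd ⁻¹' (HH x ×ˢ HH y)) + γ.real E := by
        refine le_trans ?_ (measureReal_union_le _ _)
        refine ENNReal.toReal_mono (measure_ne_top _ _) (measure_mono_ae ?_)
        filter_upwards [ae1] with z hz h1
        by_cases hE' : z ∈ E
        · exact Or.inr hE'
        · exact Or.inl ((hside z hz hE' x y).1 h1)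
      have i2 : γ.real (Prod.snd ⁻¹' (HH x ×ˢ HH y)) ≤ γ.real (Prod.fst ⁻¹' (HH x ×ˢ HH y)) + γ.real E := by
        refine le_trans ?_ (measureReal_union_le _ _)
        refine ENNReal.toReal_mono (measure_ne_top _ _) (measure_mono_ae ?_)
        filter_upwards [ae1] with z hz h1
        by_cases hE' : z ∈ E
        · exact Or.inr hE'
        · exact Or.inl ((hside z hz hE' x y).2 h1)
      constructor <;> linarith
    have := alg_HH ha q q' hA
    linarith
  rw [W2]
  apply Real.le_sqrt_of_sq_le
  rw [div_pow, Real.sq_sqrt (abs_nonneg a)]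
  norm_num
  linarith

theorem exists_eta (m : ℕ) (hm : 0 < m) (ν : Fin m → Bool) :
    ∃ η : ℝ → ℝ, Measurable η ∧ (∀ z, |η z| ≤ 1) ∧ (∀ z z', |η z - η z'| ≤ 2 * |z - z'|) ∧
      ∀ j, η (zf m j) = sg (ν j) / m := by
  have hm0 : (0:ℝ) < m := by exact_mod_cast hm
  have hm1 : (1:ℝ) ≤ m := by exact_mod_cast hm
  have hinj : Function.Injective (zf m) := by
    intro i j h
    simp only [zf] at h
    have h' : (i:ℝ) = j := by field_simp at h; exact h
    exact Fin.ext (by exact_mod_cast h')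
  set f : ℝ → ℝ := Function.extend (zf m) (fun j => sg (ν j) / m) 0 with hf
  have hfz : ∀ j, f (zf m j) = sg (ν j) / m := fun j => hinj.extend_apply _ _ j
  have hL : LipschitzOnWith 2 f (Set.range (zf m)) := by
    refine LipschitzOnWith.of_dist_le_mul ?_
    rintro _ ⟨i, rfl⟩ _ ⟨j, rfl⟩
    rw [hfz, hfz, Real.dist_eq, Real.dist_eq]
    by_cases hij : i = j
    · simp [hij]
    have h1 : (1:ℝ) ≤ |(i:ℝ) - j| := by
      have : (i:ℤ) - j ≠ 0 := by
        intro h; apply hij; apply Fin.ext; omega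
      have := Int.one_le_abs this
      exact_mod_cast this
    have h2 : |zf m i - zf m j| = |(i:ℝ) - j| / m := by
      rw [zf, zf, ← sub_div, abs_div, abs_of_pos hm0]
    have h3 : |sg (ν i) / m - sg (ν j) / m| = |sg (ν i) - sg (ν j)| / m := by
      rw [← sub_div, abs_div, abs_of_pos hm0]
    rw [h2, h3]
    have h4 : |sg (ν i) - sg (ν j)| ≤ 2 := by
      refine (abs_sub _ _).trans ?_
      rw [sg_abs, sg_abs]; norm_num
    have h5 : ((2:NNReal):ℝ) = 2 := rfl
    rw [h5, ← mul_div_assoc]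
    gcongr
    linarith
  obtain ⟨g, hg, hfg⟩ := hL.extend_real
  have hgl : ∀ z z', |g z - g z'| ≤ 2 * |z - z'| := by
    intro z z'
    have := hg.dist_le_mul z z'
    rwa [Real.dist_eq, Real.dist_eq] at this
  refine ⟨fun z => max (-1) (min 1 (g z)), ?_, ?_, ?_, ?_⟩
  · have := hg.continuous.measurable
    fun_prop
  · intro z
    rw [abs_le]
    exact ⟨le_max_left _ _, max_le (by norm_num) (min_le_left _ _)⟩
  · intro z z'
    refine le_trans ?_ (hgl z z')
    refine (abs_max_sub_max_le_max _ _ _ _).trans ?_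
    refine max_le (by simp) ?_
    refine (abs_min_sub_min_le_max _ _ _ _).trans ?_
    exact max_le (by simp) le_rfl
  · intro j
    have h1 := hfg ⟨j, rfl⟩
    have h2 : |sg (ν j) / m| ≤ 1 := by
      rw [abs_div, sg_abs, abs_of_pos hm0, div_le_one hm0]; exact hm1
    rw [abs_le] at h2
    simp only
    rw [← h1, hfz, min_eq_right h2.2, max_eq_right h2.1]

theorem smooth_KK {L : ℝ} (hL : 1 ≤ L) {η : ℝ → ℝ} (h : ∀ z, |η z| ≤ 1)
    (hl : ∀ z z', |η z - η z'| ≤ 2 * |z - z'|) : WSmooth L (fun z => KK (η z)) := by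
  intro z _ z' _
  have h1 := W1_KK (h z) (h z')
  have h2 := hl z z'
  have h3 := mul_le_mul_of_nonneg_right hL (abs_nonneg (z - z'))
  linarith


/-- (Minimax lower bound.) There are absolute constants `c₀, L₀ > 0` such
that for every `L ≥ L₀`, every sample size `n` and every Borel measurable test
`ψ : ([0,1]³)ⁿ → [0,1]`, with `ε = c₀·n^{-1/5}` the sum of the worst-case type I and type II
errors exceeds `1/3`: there are `p₀ ∈ P₀^W(L)` and `p₁ ∈ P₁^W(L,ε)` with
`E_{p₀⊗n}[ψ] + E_{p₁⊗n}[1 − ψ] > 1/3`.  In particular the critical radius satisfies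
`ε_n ≥ c₀·n^{-1/5}`. -/
theorem minimax_lower_bound :
    ∃ c₀ L₀ : ℝ, 0 < c₀ ∧ 0 < L₀ ∧
      ∀ L : ℝ, L₀ ≤ L → ∀ n : ℕ, 0 < n →
        ∀ ψ : (Fin n → (ℝ × ℝ) × ℝ) → ℝ, Measurable ψ → (∀ ω, ψ ω ∈ Set.Icc (0 : ℝ) 1) →
          ∃ (p₀ p₁ : Measure ((ℝ × ℝ) × ℝ)) (κ₀ κ₁ : ℝ → Measure (ℝ × ℝ)),
            InNullClass L p₀ κ₀ ∧
            InAltClass L (c₀ * ((n : ℝ) ^ ((1 : ℝ) / 5))⁻¹) p₁ κ₁ ∧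
            (1 : ℝ) / 3 < (∫ ω, ψ ω ∂(Measure.pi fun _ : Fin n => p₀)) +
              (1 - ∫ ω, ψ ω ∂(Measure.pi fun _ : Fin n => p₁)) := by
  refine ⟨1/16, 1, by norm_num, by norm_num, ?_⟩
  intro L hL n hn ψ _ hψ
  have hn0 : (0:ℝ) < n := by exact_mod_cast hn
  have hn1 : (1:ℝ) ≤ n := by exact_mod_cast hn
  set r : ℝ := (n : ℝ) ^ ((1 : ℝ) / 5) with hr
  have hr1 : 1 ≤ r := Real.one_le_rpow hn1 (by norm_num)
  have hr5 : r ^ 5 = n := by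
    rw [hr, ← Real.rpow_natCast, ← Real.rpow_mul hn0.le]; norm_num
  set m : ℕ := ⌈2 * r^2⌉₊ with hmdef
  have hm2 : 2 * r^2 ≤ m := Nat.le_ceil _
  have hr2 : 1 ≤ r^2 := one_le_pow₀ hr1
  have hm3 : (m:ℝ) ≤ 4 * r^2 := by
    have := (Nat.ceil_lt_add_one (by positivity : 0 ≤ 2 * r^2)).le
    linarith
  have hm0 : (0:ℝ) < m := by linarith
  have hm : 0 < m := by exact_mod_cast hm0
  have hmn : 32 * (n:ℝ)^2 ≤ (m:ℝ)^5 := by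
    calc 32 * (n:ℝ)^2 = (2 * r^2)^5 := by rw [← hr5]; ring
      _ ≤ _ := by gcongr
  obtain ⟨ν, hν⟩ := core_finite m n hm hmn (fun ω => ψ (fun i => TT m (ω i))) (fun ω => hψ _)
  obtain ⟨η, ηm, η1, ηl, ηz⟩ := exists_eta m hm ν
  have z1 : ∀ z : ℝ, |(fun _ : ℝ => (0:ℝ)) z| ≤ 1 := by simp
  have hηj : ∀ j, |η (zf m j)| = 1 / m := by
    intro j; rw [ηz, abs_div, sg_abs, abs_of_pos hm0]
  refine ⟨PP m (fun _ => 0), PP m η, fun _ => KK 0, fun z => KK (η z), ?_, ?_, ?_⟩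
  · refine ⟨PP_prob m hm z1, PP_one m hm z1 pt_mem (zf_mem m), cond_PP m z1 measurable_const,
      smooth_KK hL z1 (by simp), ?_⟩
    exact ae_of_all _ fun _ => KK_zero
  · refine ⟨PP_prob m hm η1, PP_one m hm η1 pt_mem (zf_mem m), cond_PP m η1 ηm,
      smooth_KK hL η1 ηl, ?_, ?_⟩
    · rw [PP_snd m η1, ae_PZ hm]
      intro h
      have h0 := h ⟨0, hm⟩
      have hK := KK_prob (η1 (zf m ⟨0, hm⟩))
      have i1 : IsProbabilityMeasure ((KK (η (zf m ⟨0, hm⟩))).map Prod.fst) :=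
        Measure.isProbabilityMeasure_map measurable_fst.aemeasurable
      have i2 : IsProbabilityMeasure ((KK (η (zf m ⟨0, hm⟩))).map Prod.snd) :=
        Measure.isProbabilityMeasure_map measurable_snd.aemeasurable
      have := alg_HH (t := 0) (η1 (zf m ⟨0, hm⟩)) _ _ (fun x y => by
        rw [prodMargins] at h0
        rw [← h0]; simp)
      rw [hηj] at this
      have h1 : (0:ℝ) < 1 / m := by positivity
      linarith
    · intro qX qY hX hY
      rw [PP_snd m η1, int_PZ]
      have hlow : ∀ j, 1/16 * r⁻¹ ≤ W2 (KK (η (zf m j))) ((qX (zf m j)).prod (qY (zf m j))) := by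
        intro j
        have := hX.1 (zf m j)
        have := hY.1 (zf m j)
        refine le_trans ?_ (W2_KK (η1 _) _ _ (hX.2.1 _ (zf_mem m j)) (hY.2.1 _ (zf_mem m j)))
        rw [hηj]
        have h1 : r⁻¹ / 2 ≤ Real.sqrt (1 / m) := by
          apply Real.le_sqrt_of_sq_le
          rw [div_pow, inv_pow, le_div_iff₀ hm0]
          calc (r^2)⁻¹ / 2^2 * m ≤ (r^2)⁻¹ / 2^2 * (4 * r^2) := by gcongr
            _ = 1 := by field_simp; norm_num
        linarith
      calc 1/16 * r⁻¹ = ∑ j : Fin m, 1/(m:ℝ) * (1/16 * r⁻¹) := by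
            rw [Finset.sum_const, Finset.card_univ, Fintype.card_fin, nsmul_eq_mul]; field_simp
        _ ≤ _ := Finset.sum_le_sum fun j _ => mul_le_mul_of_nonneg_left (hlow j) (by positivity)
  · rw [int_pi_PP m n hm z1, int_pi_PP m n hm η1]
    simp only [ww, ηz]
    linarith

end
end

section
/- There is an absolute constant κ such that the following holds. Let p be a Borel probability measure on [0,1]³ with coordinates (X,Y,Z) satisfying W1(p_{X,Y|Z=z}, p_{X,Y|Z=z'}) ≤ L·|z−z'| for all z, z' ∈ [0,1]. Let C₁,…,C_d be a partition of [0,1] into intervals, each of positive p_Z-measure, and write p_m = p_Z(C_m). Then ∫ W2(p_{X,Y|Z=z}, p_{X|Z=z} × p_{Y|Z=z}) dp_Z(z) ≤ Σ_{m=1}^{d} W2(p_{X,Y|Z∈C_m}, p_{X|Z∈C_m} × p_{Y|Z∈C_m})·p_m + κ·(L·max_{m∈[d]} diam(C_m))^{1/2}, where p_{X,Y|Z∈C_m} denotes the conditional distribution of (X,Y) given Z ∈ C_m, with marginals p_{X|Z∈C_m}, p_{Y|Z∈C_m}. -/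
open MeasureTheory

noncomputable section

def cst (x y : ℝ × ℝ) : ℝ := (x.1 - y.1) ^ 2 + (x.2 - y.2) ^ 2

lemma cst_nonneg (x y : ℝ × ℝ) : 0 ≤ cst x y := by unfold cst; positivity

lemma cst_meas : Measurable (fun w : (ℝ × ℝ) × (ℝ × ℝ) => cst w.1 w.2) := by
  unfold cst; fun_prop

lemma measurableSet_unitSq : MeasurableSet unitSq := measurableSet_Icc.prod measurableSet_Icc

lemma cst_le_two {x y : ℝ × ℝ} (hx : x ∈ unitSq) (hy : y ∈ unitSq) : cst x y ≤ 2 := by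
  obtain ⟨⟨a, b⟩, c, d⟩ := hx
  obtain ⟨⟨e, f⟩, g, h⟩ := hy
  unfold cst
  nlinarith

/-- existence of a coupling of cost at most `c` -/
def Cpl (c : ℝ) (μ ν : Measure (ℝ × ℝ)) : Prop :=
  ∃ γ : Measure ((ℝ × ℝ) × (ℝ × ℝ)), IsProbabilityMeasure γ ∧ IsCoupling γ μ ν ∧
    ∫ w, cst w.1 w.2 ∂γ ≤ c

lemma coupling_ae {γ : Measure ((ℝ × ℝ) × (ℝ × ℝ))} {μ ν : Measure (ℝ × ℝ)}
    (h : IsCoupling γ μ ν) (hμ : ∀ᵐ x ∂μ, x ∈ unitSq) (hν : ∀ᵐ x ∂ν, x ∈ unitSq) :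
    ∀ᵐ w ∂γ, w.1 ∈ unitSq ∧ w.2 ∈ unitSq := by
  rw [← h.1] at hμ
  rw [← h.2] at hν
  exact (ae_of_ae_map measurable_fst.aemeasurable hμ).and
    (ae_of_ae_map measurable_snd.aemeasurable hν)

lemma integrable_of_ae {γ : Measure ((ℝ × ℝ) × (ℝ × ℝ))} [IsFiniteMeasure γ]
    (h : ∀ᵐ w ∂γ, w.1 ∈ unitSq ∧ w.2 ∈ unitSq) :
    Integrable (fun w => cst w.1 w.2) γ := by
  refine Integrable.of_bound cst_meas.aestronglyMeasurable 2 ?_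
  filter_upwards [h] with w hw
  rw [Real.norm_eq_abs, abs_of_nonneg (cst_nonneg _ _)]
  exact cst_le_two hw.1 hw.2

lemma W2_nonneg (μ ν : Measure (ℝ × ℝ)) : 0 ≤ W2 μ ν := Real.sqrt_nonneg _

lemma W2_le_of_Cpl {μ ν : Measure (ℝ × ℝ)} {c : ℝ} (h : Cpl c μ ν) : W2 μ ν ≤ √c := by
  obtain ⟨γ, h1, h2, h3⟩ := h
  refine Real.sqrt_le_sqrt (le_trans (csInf_le ?_ ⟨γ, h1, h2, rfl⟩) h3)
  refine ⟨0, ?_⟩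
  rintro _ ⟨γ', -, -, rfl⟩
  exact integral_nonneg fun w => cst_nonneg _ _

lemma exists_of_transportCost_lt {cost : (ℝ × ℝ) → (ℝ × ℝ) → ℝ} {μ ν : Measure (ℝ × ℝ)}
    [IsProbabilityMeasure μ] [IsProbabilityMeasure ν] {a : ℝ} (h : transportCost cost μ ν < a) :
    ∃ γ : Measure ((ℝ × ℝ) × (ℝ × ℝ)), IsProbabilityMeasure γ ∧ IsCoupling γ μ ν ∧
      ∫ w, cost w.1 w.2 ∂γ < a := by
  have hne : {c : ℝ | ∃ γ : Measure ((ℝ × ℝ) × (ℝ × ℝ)), IsProbabilityMeasure γ ∧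
      IsCoupling γ μ ν ∧ c = ∫ z, cost z.1 z.2 ∂γ}.Nonempty :=
    ⟨_, μ.prod ν, inferInstance, ⟨by simp, by simp⟩, rfl⟩
  obtain ⟨_, ⟨γ, h1, h2, rfl⟩, h3⟩ := exists_lt_of_csInf_lt hne h
  exact ⟨γ, h1, h2, h3⟩

lemma Cpl_of_W2_lt {μ ν : Measure (ℝ × ℝ)} [IsProbabilityMeasure μ] [IsProbabilityMeasure ν]
    {a : ℝ} (h : W2 μ ν < a) : Cpl (a ^ 2) μ ν := by
  have ha : 0 < a := (W2_nonneg _ _).trans_lt h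
  have := (Real.sqrt_lt' ha).1 h
  obtain ⟨γ, h1, h2, h3⟩ := exists_of_transportCost_lt this
  exact ⟨γ, h1, h2, h3.le⟩

lemma Cpl_of_W1_lt {μ ν : Measure (ℝ × ℝ)} [IsProbabilityMeasure μ] [IsProbabilityMeasure ν]
    (hμ : ∀ᵐ x ∂μ, x ∈ unitSq) (hν : ∀ᵐ x ∂ν, x ∈ unitSq)
    {a : ℝ} (h : W1 μ ν < a) : Cpl (2 * a) μ ν := by
  obtain ⟨γ, h1, h2, h3⟩ := exists_of_transportCost_lt h
  refine ⟨γ, h1, h2, ?_⟩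
  have hae := coupling_ae h2 hμ hν
  have hs : ∀ w : (ℝ × ℝ) × (ℝ × ℝ), eucDist w.1 w.2 = √(cst w.1 w.2) := fun w => rfl
  have hle : ∀ᵐ w ∂γ, √(cst w.1 w.2) ≤ 2 ∧ cst w.1 w.2 ≤ 2 * √(cst w.1 w.2) := by
    filter_upwards [hae] with w hw
    have h0 := cst_nonneg w.1 w.2
    have h2 := cst_le_two hw.1 hw.2
    have h4 : √(cst w.1 w.2) ≤ 2 := by
      rw [Real.sqrt_le_left (by norm_num)]; linarith
    refine ⟨h4, ?_⟩
    have := Real.mul_self_sqrt h0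
    nlinarith [Real.sqrt_nonneg (cst w.1 w.2)]
  calc ∫ w, cst w.1 w.2 ∂γ ≤ ∫ w, 2 * √(cst w.1 w.2) ∂γ := by
        refine integral_mono_ae (integrable_of_ae hae) ?_ (hle.mono fun w h => h.2)
        refine Integrable.const_mul ?_ _
        refine Integrable.of_bound cst_meas.sqrt.aestronglyMeasurable 2 ?_
        filter_upwards [hle] with w hw
        rw [Real.norm_eq_abs, abs_of_nonneg (Real.sqrt_nonneg _)]
        exact hw.1
    _ = 2 * ∫ w, eucDist w.1 w.2 ∂γ := by rw [integral_const_mul]; rfl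
    _ ≤ 2 * a := by linarith

lemma W1_nonneg (μ ν : Measure (ℝ × ℝ)) : 0 ≤ W1 μ ν := by
  refine Real.sInf_nonneg ?_
  rintro _ ⟨γ', -, -, rfl⟩
  exact integral_nonneg fun w => Real.sqrt_nonneg _

lemma Cpl.symm {c : ℝ} {μ ν : Measure (ℝ × ℝ)} (h : Cpl c μ ν) : Cpl c ν μ := by
  obtain ⟨γ, h1, h2, h3⟩ := h
  refine ⟨γ.map Prod.swap, Measure.isProbabilityMeasure_map measurable_swap.aemeasurable,
    ⟨?_, ?_⟩, ?_⟩
  · rw [Measure.map_map measurable_fst measurable_swap]; exact h2.2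
  · rw [Measure.map_map measurable_snd measurable_swap]; exact h2.1
  · rw [integral_map measurable_swap.aemeasurable cst_meas.aestronglyMeasurable]
    refine le_trans (le_of_eq ?_) h3
    congr 1; ext w; simp only [cst, Prod.fst_swap, Prod.snd_swap]; ring

lemma Cpl.prodMargins {c : ℝ} {μ ν : Measure (ℝ × ℝ)} 
    (hμ : ∀ᵐ x ∂μ, x ∈ unitSq) (hν : ∀ᵐ x ∂ν, x ∈ unitSq) (h : Cpl c μ ν) :
    Cpl c (prodMargins μ) (prodMargins ν) := by
  obtain ⟨γ, h1, h2, h3⟩ := h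
  have hae := coupling_ae h2 hμ hν
  let f1 : (ℝ × ℝ) × (ℝ × ℝ) → ℝ × ℝ := fun w => (w.1.1, w.2.1)
  let f2 : (ℝ × ℝ) × (ℝ × ℝ) → ℝ × ℝ := fun w => (w.1.2, w.2.2)
  have hf1 : Measurable f1 := by fun_prop
  have hf2 : Measurable f2 := by fun_prop
  let g : (ℝ × ℝ) × (ℝ × ℝ) → (ℝ × ℝ) × (ℝ × ℝ) := fun w => ((w.1.1, w.2.1), (w.1.2, w.2.2))
  have hg : Measurable g := by fun_prop
  have p1 : IsProbabilityMeasure (γ.map f1) := Measure.isProbabilityMeasure_map hf1.aemeasurable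
  have p2 : IsProbabilityMeasure (γ.map f2) := Measure.isProbabilityMeasure_map hf2.aemeasurable
  refine ⟨((γ.map f1).prod (γ.map f2)).map g, Measure.isProbabilityMeasure_map hg.aemeasurable,
    ⟨?_, ?_⟩, ?_⟩
  · rw [Measure.map_map measurable_fst hg, ← h2.1, _root_.prodMargins,
      Measure.map_map measurable_fst measurable_fst, Measure.map_map measurable_snd measurable_fst]
    have : (Prod.fst ∘ g) = Prod.map Prod.fst Prod.fst := rfl
    rw [this, ← Measure.map_prod_map _ _ measurable_fst measurable_fst,
      Measure.map_map measurable_fst hf1, Measure.map_map measurable_fst hf2]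
    rfl
  · rw [Measure.map_map measurable_snd hg, ← h2.2, _root_.prodMargins,
      Measure.map_map measurable_fst measurable_snd, Measure.map_map measurable_snd measurable_snd]
    have : (Prod.snd ∘ g) = Prod.map Prod.snd Prod.snd := rfl
    rw [this, ← Measure.map_prod_map _ _ measurable_snd measurable_snd,
      Measure.map_map measurable_snd hf1, Measure.map_map measurable_snd hf2]
    rfl
  · rw [integral_map hg.aemeasurable cst_meas.aestronglyMeasurable]
    have hm : Measurable (fun u : ℝ × ℝ => (u.1 - u.2) ^ 2) := by fun_prop
    have i1' : Integrable (fun w : (ℝ × ℝ) × (ℝ × ℝ) => (w.1.1 - w.2.1) ^ 2) γ := by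
      refine Integrable.of_bound (by fun_prop) 2 ?_
      filter_upwards [hae] with w hw
      have := cst_le_two hw.1 hw.2
      rw [Real.norm_eq_abs, abs_of_nonneg (sq_nonneg _)]
      unfold cst at this; nlinarith [sq_nonneg (w.1.2 - w.2.2)]
    have i2' : Integrable (fun w : (ℝ × ℝ) × (ℝ × ℝ) => (w.1.2 - w.2.2) ^ 2) γ := by
      refine Integrable.of_bound (by fun_prop) 2 ?_
      filter_upwards [hae] with w hw
      have := cst_le_two hw.1 hw.2
      rw [Real.norm_eq_abs, abs_of_nonneg (sq_nonneg _)]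
      unfold cst at this; nlinarith [sq_nonneg (w.1.1 - w.2.1)]
    have i1 : Integrable (fun u : ℝ × ℝ => (u.1 - u.2) ^ 2) (γ.map f1) :=
      (integrable_map_measure hm.aestronglyMeasurable hf1.aemeasurable).2 i1'
    have i2 : Integrable (fun u : ℝ × ℝ => (u.1 - u.2) ^ 2) (γ.map f2) :=
      (integrable_map_measure hm.aestronglyMeasurable hf2.aemeasurable).2 i2'
    have e : ∀ w : (ℝ × ℝ) × (ℝ × ℝ), cst (g w).1 (g w).2
        = (w.1.1 - w.1.2) ^ 2 + (w.2.1 - w.2.2) ^ 2 := fun w => rfl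
    simp_rw [e]
    rw [integral_add (i1.comp_fst _) (i2.comp_snd _),
      integral_fun_fst (fun u : ℝ × ℝ => (u.1 - u.2) ^ 2),
      integral_fun_snd (fun u : ℝ × ℝ => (u.1 - u.2) ^ 2),
      integral_map hf1.aemeasurable hm.aestronglyMeasurable,
      integral_map hf2.aemeasurable hm.aestronglyMeasurable]
    simp only [probReal_univ, one_smul]
    rw [← integral_add i1' i2']
    exact h3

open ProbabilityTheory in
lemma exists_glue {γ₁ γ₂ : Measure ((ℝ × ℝ) × (ℝ × ℝ))} [IsProbabilityMeasure γ₁]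
    [IsProbabilityMeasure γ₂] (h : γ₁.map Prod.snd = γ₂.map Prod.fst) :
    ∃ Θ : Measure (((ℝ × ℝ) × (ℝ × ℝ)) × (ℝ × ℝ)), IsProbabilityMeasure Θ ∧
      Θ.map Prod.fst = γ₁ ∧ Θ.map (fun w => (w.1.2, w.2)) = γ₂ := by
  have hm : Measurable (fun w : ((ℝ × ℝ) × (ℝ × ℝ)) × (ℝ × ℝ) => (w.1.2, w.2)) := by fun_prop
  refine ⟨γ₁ ⊗ₘ (Kernel.prodMkLeft (ℝ × ℝ) γ₂.condKernel), inferInstance, ?_, ?_⟩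
  · exact Measure.fst_compProd _ _
  · conv_rhs => rw [← γ₂.disintegrate γ₂.condKernel]
    ext s hs
    rw [Measure.map_apply hm hs, Measure.compProd_apply (hm hs), Measure.compProd_apply hs,
      Measure.fst, ← h, lintegral_map (Kernel.measurable_kernel_prodMk_left hs) measurable_snd]
    rfl

lemma W2_triangle {μ ν ρ : Measure (ℝ × ℝ)} [IsProbabilityMeasure μ] [IsProbabilityMeasure ν]
    [IsProbabilityMeasure ρ] (hμ : ∀ᵐ x ∂μ, x ∈ unitSq) (hν : ∀ᵐ x ∂ν, x ∈ unitSq)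
    (hρ : ∀ᵐ x ∂ρ, x ∈ unitSq) : W2 μ ρ ≤ W2 μ ν + W2 ν ρ := by
  have key : ∀ a b, W2 μ ν < a → W2 ν ρ < b → W2 μ ρ ≤ a + b := by
    intro a b ha hb
    have a0 : 0 < a := (W2_nonneg _ _).trans_lt ha
    have b0 : 0 < b := (W2_nonneg _ _).trans_lt hb
    obtain ⟨γ₁, p1, c1, l1⟩ := Cpl_of_W2_lt ha
    obtain ⟨γ₂, p2, c2, l2⟩ := Cpl_of_W2_lt hb
    obtain ⟨Θ, pΘ, e1, e2⟩ := exists_glue (c1.2.trans c2.1.symm)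
    have m1 : Measurable (Prod.fst : ((ℝ × ℝ) × (ℝ × ℝ)) × (ℝ × ℝ) → _) := measurable_fst
    have m2 : Measurable (fun w : ((ℝ × ℝ) × (ℝ × ℝ)) × (ℝ × ℝ) => (w.1.2, w.2)) := by fun_prop
    have m3 : Measurable (fun w : ((ℝ × ℝ) × (ℝ × ℝ)) × (ℝ × ℝ) => (w.1.1, w.2)) := by fun_prop
    have i1 := integrable_of_ae (coupling_ae c1 hμ hν)
    have i2 := integrable_of_ae (coupling_ae c2 hν hρ)
    rw [← e1, integral_map m1.aemeasurable cst_meas.aestronglyMeasurable] at l1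
    rw [← e2, integral_map m2.aemeasurable cst_meas.aestronglyMeasurable] at l2
    rw [← e1, integrable_map_measure cst_meas.aestronglyMeasurable m1.aemeasurable] at i1
    rw [← e2, integrable_map_measure cst_meas.aestronglyMeasurable m2.aemeasurable] at i2
    have hc3 : IsCoupling (Θ.map (fun w => (w.1.1, w.2))) μ ρ := by
      constructor
      · rw [Measure.map_map measurable_fst m3, ← c1.1, ← e1, Measure.map_map measurable_fst m1]
        rfl
      · rw [Measure.map_map measurable_snd m3, ← c2.2, ← e2, Measure.map_map measurable_snd m2]
        rfl
    have p3 : IsProbabilityMeasure (Θ.map (fun w => (w.1.1, w.2))) :=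
      Measure.isProbabilityMeasure_map m3.aemeasurable
    have i3 := integrable_of_ae (coupling_ae hc3 hμ hρ)
    rw [integrable_map_measure cst_meas.aestronglyMeasurable m3.aemeasurable] at i3
    change Integrable (fun w => cst w.1.1 w.1.2) Θ at i1
    change Integrable (fun w => cst w.1.2 w.2) Θ at i2
    have : Cpl ((a + b) ^ 2) μ ρ := by
      refine ⟨Θ.map (fun w => (w.1.1, w.2)), p3, hc3, ?_⟩
      rw [integral_map m3.aemeasurable cst_meas.aestronglyMeasurable]
      calc ∫ w, cst w.1.1 w.2 ∂Θ
          ≤ ∫ w, ((1 + b / a) * cst w.1.1 w.1.2 + (1 + a / b) * cst w.1.2 w.2) ∂Θ := by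
            refine integral_mono i3 ((i1.const_mul _).add (i2.const_mul _)) ?_
            intro w
            have hp : ∀ x y : ℝ, (x + y) ^ 2 ≤ (1 + b / a) * x ^ 2 + (1 + a / b) * y ^ 2 := by
              intro x y
              have : (1 + b / a) * x ^ 2 + (1 + a / b) * y ^ 2 - (x + y) ^ 2
                  = (b * x - a * y) ^ 2 / (a * b) := by field_simp; ring
              have h' : 0 ≤ (b * x - a * y) ^ 2 / (a * b) := by positivity
              linarith
            have h1 := hp (w.1.1.1 - w.1.2.1) (w.1.2.1 - w.2.1)
            have h2 := hp (w.1.1.2 - w.1.2.2) (w.1.2.2 - w.2.2)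
            simp only [sub_add_sub_cancel] at h1 h2
            simp only [cst]
            linarith
        _ = (1 + b / a) * ∫ w, cst w.1.1 w.1.2 ∂Θ + (1 + a / b) * ∫ w, cst w.1.2 w.2 ∂Θ := by
            rw [integral_add (i1.const_mul _) (i2.const_mul _), integral_const_mul,
              integral_const_mul]
        _ ≤ (1 + b / a) * a ^ 2 + (1 + a / b) * b ^ 2 := by gcongr
        _ = (a + b) ^ 2 := by field_simp; ring
    have := W2_le_of_Cpl this
    rwa [Real.sqrt_sq (by positivity)] at this
  refine le_of_forall_pos_le_add fun ε hε => ?_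
  have := key (W2 μ ν + ε / 2) (W2 ν ρ + ε / 2) (by linarith) (by linarith)
  linarith

lemma map_finsum_aux {α β ι : Type*} [MeasurableSpace α] [MeasurableSpace β] (s : Finset ι)
    (γ : ι → Measure α) {f : α → β} (hf : Measurable f) :
    (∑ i ∈ s, γ i).map f = ∑ i ∈ s, (γ i).map f := by
  ext t ht
  rw [Measure.map_apply hf ht, Measure.finsetSum_apply, Measure.finsetSum_apply]
  exact Finset.sum_congr rfl fun i _ => (Measure.map_apply hf ht).symm

lemma Cpl_mix {ι : Type*} (s : Finset ι) (w : ι → ENNReal) (ν : ι → Measure (ℝ × ℝ))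
    {μ : Measure (ℝ × ℝ)} {c : ℝ} (hμ : ∀ᵐ x ∂μ, x ∈ unitSq)
    (hν : ∀ i ∈ s, ∀ᵐ x ∂(ν i), x ∈ unitSq)
    (hw : ∑ i ∈ s, w i = 1) (h : ∀ i ∈ s, Cpl c μ (ν i)) :
    Cpl c μ (∑ i ∈ s, w i • ν i) := by
  choose! γ h1 h2 h3 using h
  have hwt : ∀ i ∈ s, w i ≠ ⊤ := fun i hi => by
    have : w i ≤ 1 := hw ▸ Finset.single_le_sum (fun _ _ => zero_le) hi
    exact ne_top_of_le_ne_top ENNReal.one_ne_top this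
  have hsum : ∑ i ∈ s, (w i).toReal = 1 := by
    rw [← ENNReal.toReal_sum hwt, hw, ENNReal.toReal_one]
  have hi : ∀ i ∈ s, Integrable (fun v => cst v.1 v.2) (w i • γ i) := fun i hi => by
    have := h1 i hi
    exact (integrable_of_ae (coupling_ae (h2 i hi) hμ (hν i hi))).smul_measure (hwt i hi)
  refine ⟨∑ i ∈ s, w i • γ i, ⟨?_⟩, ⟨?_, ?_⟩, ?_⟩
  · rw [Measure.finsetSum_apply, ← hw]
    refine Finset.sum_congr rfl fun i hi => ?_
    have := h1 i hi
    simp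
  · rw [map_finsum_aux _ _ measurable_fst]
    rw [Finset.sum_congr rfl (g := fun i => w i • μ) fun i hi => by
      rw [Measure.map_smul, (h2 i hi).1], ← Finset.sum_smul, hw, one_smul]
  · rw [map_finsum_aux _ _ measurable_snd]
    refine Finset.sum_congr rfl fun i hi => ?_
    rw [Measure.map_smul, (h2 i hi).2]
  · rw [integral_finsetSum_measure hi]
    calc ∑ i ∈ s, ∫ v, cst v.1 v.2 ∂(w i • γ i) ≤ ∑ i ∈ s, (w i).toReal * c := by
          refine Finset.sum_le_sum fun i hi => ?_
          rw [integral_smul_measure, smul_eq_mul]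
          exact mul_le_mul_of_nonneg_left (h3 i hi) ENNReal.toReal_nonneg
      _ = c := by rw [← Finset.sum_mul, hsum, one_mul]

lemma exists_remainder {μ ν : Measure (ℝ × ℝ)} (hfin : μ Set.univ ≠ ⊤)
    (h : μ Set.univ = ν Set.univ) :
    ∃ r : Measure ((ℝ × ℝ) × (ℝ × ℝ)), IsCoupling r μ ν := by
  have : IsFiniteMeasure μ := ⟨hfin.lt_top⟩
  have : IsFiniteMeasure ν := ⟨(h ▸ hfin).lt_top⟩
  by_cases h0 : μ Set.univ = 0
  · have h0' : ν Set.univ = 0 := h ▸ h0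
    rw [Measure.measure_univ_eq_zero] at h0 h0'
    exact ⟨0, by simp [IsCoupling, h0, h0']⟩
  · refine ⟨(μ Set.univ)⁻¹ • μ.prod ν, ?_, ?_⟩
    · rw [Measure.map_smul, Measure.map_fst_prod, ← h, smul_smul,
        ENNReal.inv_mul_cancel h0 hfin, one_smul]
    · rw [Measure.map_smul, Measure.map_snd_prod, smul_smul,
        ENNReal.inv_mul_cancel h0 hfin, one_smul]

lemma Cpl_cells {ι : Type*} [Fintype ι] {μ ν : Measure (ℝ × ℝ)} [IsProbabilityMeasure μ]
    [IsProbabilityMeasure ν] (hμ : ∀ᵐ x ∂μ, x ∈ unitSq) (hν : ∀ᵐ x ∂ν, x ∈ unitSq)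
    (A : ι → Set (ℝ × ℝ)) (hA : ∀ i, MeasurableSet (A i)) (hd : Pairwise (Function.onFun Disjoint A))
    {ε δ : ℝ} (hε : 0 ≤ ε) (hc : ∀ i, ∀ x ∈ A i, ∀ y ∈ A i, cst x y ≤ ε)
    (m : ι → ENNReal) (h1 : ∀ i, m i ≤ μ (A i)) (h2 : ∀ i, m i ≤ ν (A i))
    (hδ : 1 - δ ≤ ∑ i, (m i).toReal) : Cpl (ε + 2 * δ) μ ν := by
  have hmt : ∀ i, m i ≠ ⊤ := fun i => ne_top_of_le_ne_top (measure_ne_top _ _) (h1 i)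
  have sub : ∀ (ρ : Measure (ℝ × ℝ)), (∀ i, m i ≤ ρ (A i)) →
      ∑ i, (m i / ρ (A i)) • ρ.restrict (A i) ≤ ρ := by
    intro ρ hρ
    refine Measure.le_iff.2 fun s hs => ?_
    rw [Measure.finsetSum_apply]
    calc ∑ i, ((m i / ρ (A i)) • ρ.restrict (A i)) s ≤ ∑ i, ρ (s ∩ A i) := by
          refine Finset.sum_le_sum fun i _ => ?_
          rw [Measure.smul_apply, Measure.restrict_apply hs, smul_eq_mul]
          exact mul_le_of_le_one_left zero_le (ENNReal.div_le_of_le_mul (by simpa using hρ i))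
      _ = ρ (⋃ i, s ∩ A i) := by
          rw [measure_iUnion (fun i j hij => (hd hij).mono Set.inter_subset_right
            Set.inter_subset_right) fun i => hs.inter (hA i), tsum_fintype]
      _ ≤ ρ s := measure_mono (by simp)
  have tot : ∀ (ρ : Measure (ℝ × ℝ)), IsProbabilityMeasure ρ → (∀ i, m i ≤ ρ (A i)) →
      (∑ i, (m i / ρ (A i)) • ρ.restrict (A i)) Set.univ = ∑ i, m i := by
    intro ρ _ hρ
    rw [Measure.finsetSum_apply]
    refine Finset.sum_congr rfl fun i _ => ?_
    rw [Measure.smul_apply, Measure.restrict_apply_univ, smul_eq_mul]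
    refine ENNReal.div_mul_cancel' (fun h => ?_) fun h => absurd h (measure_ne_top _ _)
    simpa [h] using hρ i
  set μ' := ∑ i, (m i / μ (A i)) • μ.restrict (A i) with hμ'
  set ν' := ∑ i, (m i / ν (A i)) • ν.restrict (A i) with hν'
  have lμ : μ' ≤ μ := sub μ h1
  have lν : ν' ≤ ν := sub ν h2
  have tμ : μ' Set.univ = ∑ i, m i := tot μ inferInstance h1
  have tν : ν' Set.univ = ∑ i, m i := tot ν inferInstance h2
  have fμ : IsFiniteMeasure μ' := isFiniteMeasure_of_le _ lμ
  have fν : IsFiniteMeasure ν' := isFiniteMeasure_of_le _ lν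
  have aμ := Measure.sub_add_cancel_of_le lμ
  have aν := Measure.sub_add_cancel_of_le lν
  have um : (μ - μ') Set.univ = 1 - ∑ i, m i := by
    rw [Measure.sub_apply MeasurableSet.univ lμ, measure_univ, tμ]
  have un : (ν - ν') Set.univ = 1 - ∑ i, m i := by
    rw [Measure.sub_apply MeasurableSet.univ lν, measure_univ, tν]
  obtain ⟨r, hr⟩ := exists_remainder (μ := μ - μ') (ν := ν - ν')
    (by rw [um]; exact ENNReal.sub_ne_top ENNReal.one_ne_top) (um.trans un.symm)
  set γ' : Measure ((ℝ × ℝ) × (ℝ × ℝ)) :=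
    ∑ i, (m i / μ (A i) / ν (A i)) • (μ.restrict (A i)).prod (ν.restrict (A i)) with hγ'
  have hγc : IsCoupling γ' μ' ν' := by
    constructor
    · rw [hγ', map_finsum_aux _ _ measurable_fst]
      refine Finset.sum_congr rfl fun i _ => ?_
      rw [Measure.map_smul, Measure.map_fst_prod, smul_smul, Measure.restrict_apply_univ]
      congr 1
      refine ENNReal.div_mul_cancel' (fun h => ?_) fun h => absurd h (measure_ne_top _ _)
      have : m i = 0 := by simpa [h] using h2 i
      simp [this]
    · rw [hγ', map_finsum_aux _ _ measurable_snd]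
      refine Finset.sum_congr rfl fun i _ => ?_
      rw [Measure.map_smul, Measure.map_snd_prod, smul_smul, Measure.restrict_apply_univ]
      congr 1
      have : m i / μ (A i) / ν (A i) = m i / ν (A i) / μ (A i) := by
        simp only [div_eq_mul_inv]; ring
      rw [this]
      refine ENNReal.div_mul_cancel' (fun h => ?_) fun h => absurd h (measure_ne_top _ _)
      have : m i = 0 := by simpa [h] using h1 i
      simp [this]
  have hcoup : IsCoupling (r + γ') μ ν := by
    constructor
    · rw [Measure.map_add _ _ measurable_fst, hr.1, hγc.1, aμ]
    · rw [Measure.map_add _ _ measurable_snd, hr.2, hγc.2, aν]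
  have hprob : IsProbabilityMeasure (r + γ') := ⟨by
    have := congrArg (fun ρ => ρ Set.univ) hcoup.1
    simpa [Measure.map_apply measurable_fst] using this⟩
  have hae := coupling_ae hcoup hμ hν
  have hint := integrable_of_ae hae
  have fr : IsFiniteMeasure r := isFiniteMeasure_of_le (r + γ') (Measure.le_add_right le_rfl)
  have fg : IsFiniteMeasure γ' := isFiniteMeasure_of_le (r + γ') (Measure.le_add_left le_rfl)
  have ur : r Set.univ = 1 - ∑ i, m i := by
    rw [← um, ← hr.1, Measure.map_apply measurable_fst MeasurableSet.univ, Set.preimage_univ]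
  have hr2 : r.real Set.univ ≤ δ := by
    have hle : ∑ i, m i ≤ 1 := by rw [← tμ, ← measure_univ (μ := μ)]; exact lμ _
    rw [measureReal_def, ur, ENNReal.toReal_sub_of_le hle ENNReal.one_ne_top,
      ENNReal.toReal_sum fun i _ => hmt i, ENNReal.toReal_one]
    linarith
  have hg2 : γ'.real Set.univ ≤ 1 := by
    rw [← probReal_univ (μ := r + γ')]
    exact ENNReal.toReal_mono (measure_ne_top _ _)
      ((Measure.le_add_left le_rfl : γ' ≤ r + γ') _)
  refine ⟨r + γ', hprob, hcoup, ?_⟩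
  rw [integral_add_measure hint.left_of_add_measure hint.right_of_add_measure]
  have b1 : ∫ w, cst w.1 w.2 ∂r ≤ 2 * δ := by
    calc ∫ w, cst w.1 w.2 ∂r ≤ ∫ w, (2 : ℝ) ∂r := by
          refine integral_mono_ae hint.left_of_add_measure (integrable_const _) ?_
          filter_upwards [(ae_add_measure_iff.1 hae).1] with w hw using cst_le_two hw.1 hw.2
      _ = r.real Set.univ * 2 := by rw [integral_const, smul_eq_mul]
      _ ≤ 2 * δ := by linarith
  have b2 : ∫ w, cst w.1 w.2 ∂γ' ≤ ε := by
    calc ∫ w, cst w.1 w.2 ∂γ' ≤ ∫ w, ε ∂γ' := by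
          refine integral_mono_ae hint.right_of_add_measure (integrable_const _) ?_
          rw [hγ', Filter.EventuallyLE, ae_finsetSum_measure_iff]
          intro i _
          refine Measure.ae_smul_measure ?_ _
          rw [Measure.prod_restrict]
          filter_upwards [ae_restrict_mem ((hA i).prod (hA i))] with w hw
          exact hc i _ hw.1 _ hw.2
      _ = γ'.real Set.univ * ε := by rw [integral_const, smul_eq_mul]
      _ ≤ ε := mul_le_of_le_one_left hε hg2
  linarith

def cell (N : ℕ) (i : Fin (N + 1) × Fin (N + 1)) : Set (ℝ × ℝ) :=
  {x | x ∈ unitSq ∧ ⌊(N : ℝ) * x.1⌋₊ = i.1.val ∧ ⌊(N : ℝ) * x.2⌋₊ = i.2.val}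

lemma cell_meas (N : ℕ) (i) : MeasurableSet (cell N i) := by
  refine measurableSet_unitSq.inter (MeasurableSet.inter ?_ ?_)
  · have : Measurable fun x : ℝ × ℝ => ⌊(N : ℝ) * x.1⌋₊ := by fun_prop
    exact this (measurableSet_singleton _)
  · have : Measurable fun x : ℝ × ℝ => ⌊(N : ℝ) * x.2⌋₊ := by fun_prop
    exact this (measurableSet_singleton _)

lemma cell_disj (N : ℕ) : Pairwise (Function.onFun Disjoint (cell N)) := by
  intro i j hij
  refine Set.disjoint_left.2 fun x hx hy => hij ?_
  exact Prod.ext (Fin.ext (hx.2.1.symm.trans hy.2.1)) (Fin.ext (hx.2.2.symm.trans hy.2.2))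

lemma cell_union (N : ℕ) : (⋃ i, cell N i) = unitSq := by
  ext x
  simp only [Set.mem_iUnion]
  refine ⟨fun ⟨i, h⟩ => h.1, fun h => ?_⟩
  have hf : ∀ t : ℝ, t ∈ Set.Icc (0 : ℝ) 1 → ⌊(N : ℝ) * t⌋₊ < N + 1 := by
    intro t ht
    refine Nat.lt_succ_of_le (Nat.floor_le_of_le ?_)
    exact mul_le_of_le_one_right (Nat.cast_nonneg _) ht.2
  exact ⟨(⟨_, hf _ h.1⟩, ⟨_, hf _ h.2⟩), h, rfl, rfl⟩

lemma cell_cst {N : ℕ} (hN : 0 < N) (i) : ∀ x ∈ cell N i, ∀ y ∈ cell N i,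
    cst x y ≤ 2 / (N : ℝ) ^ 2 := by
  intro x hx y hy
  have hN' : (0 : ℝ) < N := by exact_mod_cast hN
  have key : ∀ s t : ℝ, 0 ≤ s → 0 ≤ t → ⌊(N : ℝ) * s⌋₊ = ⌊(N : ℝ) * t⌋₊ →
      (s - t) ^ 2 ≤ 1 / (N : ℝ) ^ 2 := by
    intro s t hs ht h
    have h1 := Nat.floor_le (mul_nonneg hN'.le hs)
    have h2 := Nat.lt_floor_add_one ((N : ℝ) * s)
    have h3 := Nat.floor_le (mul_nonneg hN'.le ht)
    have h4 := Nat.lt_floor_add_one ((N : ℝ) * t)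
    rw [h] at h1 h2
    rw [le_div_iff₀ (by positivity), ← mul_pow, sq_le_one_iff_abs_le_one, abs_le]
    constructor <;> nlinarith
  have h1 := key x.1 y.1 hx.1.1.1 hy.1.1.1 (hx.2.1.trans hy.2.1.symm)
  have h2 := key x.2 y.2 hx.1.2.1 hy.1.2.1 (hx.2.2.trans hy.2.2.symm)
  have : 2 / (N : ℝ) ^ 2 = 1 / (N : ℝ) ^ 2 + 1 / (N : ℝ) ^ 2 := by ring
  unfold cst
  linarith

/-- normalized mixture -/
def mixt (π : Measure ℝ) (κ : ℝ → Measure (ℝ × ℝ)) (P : Set ℝ) : Measure (ℝ × ℝ) :=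
  (π P)⁻¹ • (π.restrict P).bind κ

lemma mixt_apply {π : Measure ℝ} {κ : ℝ → Measure (ℝ × ℝ)} (hκ : Measurable κ) (P : Set ℝ)
    {A : Set (ℝ × ℝ)} (hA : MeasurableSet A) :
    mixt π κ P A = (π P)⁻¹ * ∫⁻ z in P, κ z A ∂π := by
  rw [mixt, Measure.smul_apply, Measure.bind_apply hA hκ.aemeasurable, smul_eq_mul]

lemma mixt_prob {π : Measure ℝ} [IsProbabilityMeasure π] {κ : ℝ → Measure (ℝ × ℝ)}
    (hκ : Measurable κ) (hp : ∀ z, IsProbabilityMeasure (κ z)) {P : Set ℝ} (h0 : π P ≠ 0) :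
    IsProbabilityMeasure (mixt π κ P) := ⟨by
  rw [mixt_apply hκ P MeasurableSet.univ]
  simp [ENNReal.inv_mul_cancel h0 (measure_ne_top _ _)]⟩

lemma mixt_ge {π : Measure ℝ} [IsProbabilityMeasure π] {κ : ℝ → Measure (ℝ × ℝ)}
    (hκ : Measurable κ) {P : Set ℝ} (hP : MeasurableSet P) (h0 : π P ≠ 0)
    {A : Set (ℝ × ℝ)} (hA : MeasurableSet A) {c : ENNReal} (hc : ∀ z ∈ P, c ≤ κ z A) :
    c ≤ mixt π κ P A := by
  rw [mixt_apply hκ P hA]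
  have h1 : c * π P ≤ ∫⁻ z in P, κ z A ∂π := by
    rw [← setLIntegral_const]
    exact setLIntegral_mono' hP hc
  calc c = (π P)⁻¹ * (c * π P) := by
        rw [mul_comm c, ← mul_assoc, ENNReal.inv_mul_cancel h0 (measure_ne_top _ _), one_mul]
    _ ≤ _ := by gcongr

lemma mixt_ae {π : Measure ℝ} [IsProbabilityMeasure π] {κ : ℝ → Measure (ℝ × ℝ)}
    (hκ : Measurable κ) (hp : ∀ z, IsProbabilityMeasure (κ z)) {P : Set ℝ}
    (hP : MeasurableSet P) (h0 : π P ≠ 0)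
    (hs : ∀ z ∈ P, κ z unitSq = 1) : ∀ᵐ x ∂(mixt π κ P), x ∈ unitSq := by
  have := mixt_prob hκ hp h0
  refine (mem_ae_iff_prob_eq_one measurableSet_unitSq).2 (le_antisymm prob_le_one ?_)
  exact mixt_ge hκ hP h0 measurableSet_unitSq fun z hz => (hs z hz).ge

lemma mixt_small {π : Measure ℝ} [IsProbabilityMeasure π] {κ : ℝ → Measure (ℝ × ℝ)}
    (hκ : Measurable κ) (hp : ∀ z, IsProbabilityMeasure (κ z)) {P : Set ℝ}
    (hP : MeasurableSet P) (h0 : π P ≠ 0) (hs : ∀ z ∈ P, κ z unitSq = 1)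
    {N M : ℕ} (hN : 0 < N) (hM : 0 < M) (k : Fin (N + 1) × Fin (N + 1) → ℕ)
    (hk : ∀ z ∈ P, ∀ i, ⌊(M : ℝ) * (κ z (cell N i)).toReal⌋₊ = k i) {z : ℝ} (hz : z ∈ P) :
    Cpl (2 / (N : ℝ) ^ 2 + 2 * (((N : ℝ) + 1) ^ 2 / M)) (κ z) (mixt π κ P) := by
  have hM' : (0 : ℝ) < M := by exact_mod_cast hM
  have := mixt_prob hκ hp h0
  have hlow : ∀ z ∈ P, ∀ i, ENNReal.ofReal ((k i : ℝ) / M) ≤ κ z (cell N i) := by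
    intro z hz i
    refine ENNReal.ofReal_le_of_le_toReal ?_
    rw [div_le_iff₀' hM', ← hk z hz i]
    exact Nat.floor_le (by positivity)
  refine Cpl_cells ((mem_ae_iff_prob_eq_one measurableSet_unitSq).2 (hs z hz))
    (mixt_ae hκ hp hP h0 hs) (cell N) (cell_meas N) (cell_disj N) (by positivity)
    (cell_cst hN) (fun i => ENNReal.ofReal ((k i : ℝ) / M)) (hlow z hz)
    (fun i => mixt_ge hκ hP h0 (cell_meas N i) fun z hz => hlow z hz i) ?_
  have hsum : ∑ i, (κ z (cell N i)).toReal = 1 := by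
    rw [← ENNReal.toReal_sum fun i _ => measure_ne_top _ _, ← tsum_fintype (L := .unconditional _),
      ← measure_iUnion (cell_disj N) (cell_meas N), cell_union, hs z hz, ENNReal.toReal_one]
  have hle : ∀ i, (κ z (cell N i)).toReal - 1 / M ≤ (ENNReal.ofReal ((k i : ℝ) / M)).toReal := by
    intro i
    rw [ENNReal.toReal_ofReal (by positivity), sub_le_iff_le_add, ← add_div, le_div_iff₀' hM',
      ← hk z hz i]
    exact (Nat.lt_floor_add_one _).le
  have := Finset.sum_le_sum fun i (_ : i ∈ Finset.univ) => hle i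
  rw [Finset.sum_sub_distrib, hsum] at this
  refine le_trans (le_of_eq ?_) this
  simp [Finset.card_univ]
  ring

lemma W2_mixt_le {π : Measure ℝ} [IsProbabilityMeasure π] {κ : ℝ → Measure (ℝ × ℝ)}
    (hκ : Measurable κ) (hp : ∀ z, IsProbabilityMeasure (κ z)) {P : Set ℝ}
    (hP : MeasurableSet P) (h0 : π P ≠ 0) (hs : ∀ z ∈ P, κ z unitSq = 1)
    {z : ℝ} (hz : z ∈ P) {b : ℝ} (hb0 : 0 ≤ b) (hb : ∀ z' ∈ P, W2 (κ z) (κ z') ≤ b) :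
    W2 (κ z) (mixt π κ P) ≤ b := by
  have sae : ∀ z ∈ P, ∀ᵐ x ∂(κ z), x ∈ unitSq := fun z hz =>
    (mem_ae_iff_prob_eq_one measurableSet_unitSq).2 (hs z hz)
  refine le_of_forall_pos_le_add fun η hη => ?_
  obtain ⟨N, hN, hNη⟩ : ∃ N : ℕ, 0 < N ∧ 2 / (N : ℝ) ^ 2 ≤ (η / 2) ^ 2 / 2 := by
    obtain ⟨n, hn⟩ := exists_nat_gt (4 / η)
    have hn0 : (0 : ℝ) < n := lt_trans (by positivity) hn
    refine ⟨n, by exact_mod_cast hn0, ?_⟩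
    rw [div_lt_iff₀ hη] at hn
    rw [div_le_iff₀ (by positivity)]
    nlinarith
  obtain ⟨M, hM, hMη⟩ : ∃ M : ℕ, 0 < M ∧ 2 * (((N : ℝ) + 1) ^ 2 / M) ≤ (η / 2) ^ 2 / 2 := by
    obtain ⟨n, hn⟩ := exists_nat_gt (2 * ((N : ℝ) + 1) ^ 2 / ((η / 2) ^ 2 / 2))
    have hn0 : (0 : ℝ) < n := lt_trans (by positivity) hn
    refine ⟨n, by exact_mod_cast hn0, ?_⟩
    rw [div_lt_iff₀ (by positivity)] at hn
    rw [← mul_div_assoc, div_le_iff₀ hn0]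
    linarith
  let Q : (Fin (N + 1) × Fin (N + 1) → Fin (M + 1)) → Set ℝ := fun k =>
    {z | z ∈ P ∧ ∀ i, ⌊(M : ℝ) * (κ z (cell N i)).toReal⌋₊ = (k i).val}
  have hQP : ∀ k, Q k ⊆ P := fun k z h => h.1
  have hQm : ∀ k, MeasurableSet (Q k) := by
    intro k
    have hQ : Q k = P ∩ ⋂ i, {z | ⌊(M : ℝ) * (κ z (cell N i)).toReal⌋₊ = (k i).val} := by
      ext z; simp [Q]
    rw [hQ]
    refine hP.inter ?_
    refine MeasurableSet.iInter fun i => ?_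
    have h1 : Measurable fun z => κ z (cell N i) := Measure.measurable_coe (cell_meas N i) |>.comp hκ
    have : Measurable fun z => ⌊(M : ℝ) * (κ z (cell N i)).toReal⌋₊ :=
      Nat.measurable_floor.comp (h1.ennreal_toReal.const_mul _)
    exact this (measurableSet_singleton _)
  have hQd : Pairwise (Function.onFun Disjoint Q) := by
    intro k l hkl
    refine Set.disjoint_left.2 fun x hx hy => hkl ?_
    funext i
    exact Fin.ext ((hx.2 i).symm.trans (hy.2 i))
  have hQu : (⋃ k, Q k) = P := by
    ext z
    simp only [Set.mem_iUnion]
    refine ⟨fun ⟨k, h⟩ => h.1, fun h => ?_⟩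
    have hf : ∀ i, ⌊(M : ℝ) * (κ z (cell N i)).toReal⌋₊ < M + 1 := by
      intro i
      refine Nat.lt_succ_of_le (Nat.floor_le_of_le ?_)
      exact mul_le_of_le_one_right (Nat.cast_nonneg _) measureReal_le_one
    exact ⟨fun i => ⟨_, hf i⟩, h, fun i => rfl⟩
  classical
  let s := Finset.univ.filter fun k => π (Q k) ≠ 0
  have hmix : mixt π κ P = ∑ k ∈ s, (π (Q k) / π P) • mixt π κ (Q k) := by
    ext A hA
    rw [mixt_apply hκ P hA, Measure.finsetSum_apply]
    conv_lhs => rw [← hQu, lintegral_iUnion hQm hQd, tsum_fintype, hQu, Finset.mul_sum]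
    rw [← Finset.sum_subset (Finset.filter_subset (fun k => π (Q k) ≠ 0) Finset.univ)]
    · refine Finset.sum_congr rfl fun k hk => ?_
      have hk0 : π (Q k) ≠ 0 := (Finset.mem_filter.1 hk).2
      rw [Measure.smul_apply, mixt_apply hκ _ hA, smul_eq_mul, ← mul_assoc, div_eq_mul_inv,
        mul_comm (π (Q k)), mul_assoc (π P)⁻¹, ENNReal.mul_inv_cancel hk0 (measure_ne_top _ _),
        mul_one]
    · intro k _ hk
      have hk0 : π (Q k) = 0 := by simpa using hk
      rw [Measure.restrict_eq_zero.2 hk0, lintegral_zero_measure, mul_zero]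
  have hw : ∑ k ∈ s, π (Q k) / π P = 1 := by
    have h1 : ∑ k ∈ s, π (Q k) / π P = ∑ k, π (Q k) / π P := by
      refine Finset.sum_subset (Finset.filter_subset _ _) fun k _ hk => ?_
      have hk0 : π (Q k) = 0 := by simpa [s] using hk
      simp [hk0]
    rw [h1]
    simp_rw [div_eq_mul_inv]
    rw [← Finset.sum_mul, ← tsum_fintype (L := .unconditional _), ← measure_iUnion hQd hQm, hQu,
      ENNReal.mul_inv_cancel h0 (measure_ne_top _ _)]
  have hC : Cpl ((b + η) ^ 2) (κ z) (mixt π κ P) := by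
    rw [hmix]
    have hk0 : ∀ k ∈ s, π (Q k) ≠ 0 := fun k hk => (Finset.mem_filter.1 hk).2
    refine Cpl_mix s _ _ (sae z hz)
      (fun k hk => mixt_ae hκ hp (hQm k) (hk0 k hk) fun z hz => hs z hz.1) hw ?_
    intro k hk
    have pk := mixt_prob hκ hp (hk0 k hk)
    obtain ⟨z', hz'⟩ : (Q k).Nonempty := nonempty_of_measure_ne_zero (hk0 k hk)
    refine Cpl_of_W2_lt ?_
    have t := W2_triangle (sae z hz) (sae z' hz'.1)
      (mixt_ae hκ hp (hQm k) (hk0 k hk) fun z hz => hs z hz.1)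
    have t1 := hb z' hz'.1
    have t2 := W2_le_of_Cpl (mixt_small hκ hp (hQm k) (hk0 k hk) (fun z hz => hs z hz.1) hN hM
      (fun i => (k i).val) (fun z hz => hz.2) hz')
    have t3 : √(2 / (N : ℝ) ^ 2 + 2 * (((N : ℝ) + 1) ^ 2 / M)) ≤ η / 2 := by
      rw [Real.sqrt_le_left (by positivity)]
      linarith
    linarith
  have := W2_le_of_Cpl hC
  rwa [Real.sqrt_sq (by positivity)] at this

lemma prodMargins_ae {μ : Measure (ℝ × ℝ)} [IsProbabilityMeasure μ] (hμ : ∀ᵐ x ∂μ, x ∈ unitSq) :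
    ∀ᵐ x ∂(prodMargins μ), x ∈ unitSq := by
  have p1 : IsProbabilityMeasure (μ.map Prod.fst) :=
    Measure.isProbabilityMeasure_map measurable_fst.aemeasurable
  have p2 : IsProbabilityMeasure (μ.map Prod.snd) :=
    Measure.isProbabilityMeasure_map measurable_snd.aemeasurable
  have a1 : ∀ᵐ x ∂(μ.map Prod.fst), x ∈ Set.Icc (0 : ℝ) 1 := by
    refine (ae_map_iff measurable_fst.aemeasurable
      (measurableSet_Icc (a := (0 : ℝ)) (b := 1))).2 ?_
    exact hμ.mono fun x h => h.1
  have a2 : ∀ᵐ x ∂(μ.map Prod.snd), x ∈ Set.Icc (0 : ℝ) 1 := by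
    refine (ae_map_iff measurable_snd.aemeasurable
      (measurableSet_Icc (a := (0 : ℝ)) (b := 1))).2 ?_
    exact hμ.mono fun x h => h.2
  have b1 := Measure.quasiMeasurePreserving_fst (μ := μ.map Prod.fst) (ν := μ.map Prod.snd) |>.ae a1
  have b2 := Measure.quasiMeasurePreserving_snd (μ := μ.map Prod.fst) (ν := μ.map Prod.snd) |>.ae a2
  filter_upwards [b1, b2] with x h1 h2 using ⟨h1, h2⟩

lemma prodMargins_prob {μ : Measure (ℝ × ℝ)} [IsProbabilityMeasure μ] :
    IsProbabilityMeasure (prodMargins μ) := by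
  have p1 : IsProbabilityMeasure (μ.map Prod.fst) :=
    Measure.isProbabilityMeasure_map measurable_fst.aemeasurable
  have p2 : IsProbabilityMeasure (μ.map Prod.snd) :=
    Measure.isProbabilityMeasure_map measurable_snd.aemeasurable
  unfold prodMargins
  infer_instance

lemma W2_prodMargins_le {μ ν : Measure (ℝ × ℝ)} [IsProbabilityMeasure μ] [IsProbabilityMeasure ν]
    (hμ : ∀ᵐ x ∂μ, x ∈ unitSq) (hν : ∀ᵐ x ∂ν, x ∈ unitSq) :
    W2 μ (prodMargins μ) ≤ W2 ν (prodMargins ν) + 2 * W2 μ ν := by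
  have := prodMargins_prob (μ := μ)
  have := prodMargins_prob (μ := ν)
  have h1 := W2_triangle hμ hν (prodMargins_ae hμ)
  have h2 := W2_triangle hν (prodMargins_ae hν) (prodMargins_ae hμ)
  have h3 : W2 (prodMargins ν) (prodMargins μ) ≤ W2 μ ν := by
    refine le_of_forall_gt_imp_ge_of_dense fun a ha => ?_
    have := W2_le_of_Cpl ((Cpl_of_W2_lt ha).prodMargins hμ hν).symm
    rwa [Real.sqrt_sq ((W2_nonneg _ _).trans ha.le)] at this
  linarith

lemma W2_le_of_W1 {μ ν : Measure (ℝ × ℝ)} [IsProbabilityMeasure μ] [IsProbabilityMeasure ν]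
    (hμ : ∀ᵐ x ∂μ, x ∈ unitSq) (hν : ∀ᵐ x ∂ν, x ∈ unitSq) {a : ℝ} (h : W1 μ ν ≤ a) :
    W2 μ ν ≤ √(2 * a) := by
  have ha : 0 ≤ a := (W1_nonneg _ _).trans h
  refine Real.le_sqrt_of_sq_le ?_
  refine le_of_forall_gt_imp_ge_of_dense fun c hc => ?_
  have h1 := W2_le_of_Cpl (Cpl_of_W1_lt hμ hν (a := c / 2) (by linarith))
  have h2 := Real.sq_sqrt (show (0 : ℝ) ≤ 2 * (c / 2) by linarith)
  have h3 := W2_nonneg μ ν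
  nlinarith

/-- There is an absolute constant `κ₀` such that: for any probability
measure `p` on `[0,1]³` with `W1`-Lipschitz conditional distributions (constant `L`) and any
partition `C₁,…,C_d` of `[0,1]` into intervals of positive `p_Z`-measure (`p_m = p_Z(C_m)`),
`∫ W2(p_{X,Y|Z=z}, p_{X|Z=z} × p_{Y|Z=z}) dp_Z(z)
  ≤ Σ_m W2(p_{X,Y|Z∈C_m}, p_{X|Z∈C_m} × p_{Y|Z∈C_m})·p_m + κ₀·(L·max_m diam(C_m))^{1/2}`. -/
theorem integral_w2_le_binned_w2_add :
    ∃ κ₀ : ℝ, 0 < κ₀ ∧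
      ∀ (L : ℝ) (p : Measure ((ℝ × ℝ) × ℝ)), IsProbabilityMeasure p →
        p (unitSq ×ˢ unitI) = 1 →
        ∀ κ : ℝ → Measure (ℝ × ℝ), IsCondKernel p κ → WSmooth L κ →
        ∀ (d : ℕ), 0 < d → ∀ C : Fin d → Set ℝ,
          (∀ m, MeasurableSet (C m)) →
          (∀ m, (C m).OrdConnected) →
          (Set.univ.PairwiseDisjoint C) →
          (⋃ m, C m) = unitI →
          (∀ m, 0 < p.map Prod.snd (C m)) →
          ∫ z, W2 (κ z) (prodMargins (κ z)) ∂(p.map Prod.snd) ≤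
            (∑ m, W2 (condBin p κ (C m)) (prodMargins (condBin p κ (C m))) *
              (p.map Prod.snd (C m)).toReal) +
            κ₀ * Real.sqrt (L * ⨆ m, Metric.diam (C m)) := by
  refine ⟨3, by norm_num, ?_⟩
  intro L p hp hsupp κ hκ hL d hd C hCm hCo hCd hCu hCpos
  obtain ⟨kp, ks, km, -⟩ := hκ
  set π := p.map Prod.snd with hπ
  have hπp : IsProbabilityMeasure π := Measure.isProbabilityMeasure_map measurable_snd.aemeasurable
  have kM : Measurable κ := Measure.measurable_of_measurable_coe _ km
  have hCI : ∀ m, C m ⊆ unitI := fun m => hCu ▸ Set.subset_iUnion C m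
  have hL0 : 0 ≤ L := by
    have := hL 0 (by simp [unitI]) 1 (by simp [unitI])
    have h2 := W1_nonneg (κ 0) (κ 1)
    norm_num at this
    linarith
  have hπI : π unitI = 1 := by
    refine le_antisymm prob_le_one ?_
    rw [hπ, Measure.map_apply measurable_snd (show MeasurableSet unitI from measurableSet_Icc), ← hsupp]
    exact measure_mono fun x hx => hx.2
  set D := ⨆ m, Metric.diam (C m) with hD
  have hrhs : 0 ≤ (∑ m, W2 (condBin p κ (C m)) (prodMargins (condBin p κ (C m))) *
              (π (C m)).toReal) + 3 * √(L * D) := by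
    refine add_nonneg (Finset.sum_nonneg fun m _ => ?_) (by positivity)
    exact mul_nonneg (W2_nonneg _ _) ENNReal.toReal_nonneg
  by_cases hint : Integrable (fun z => W2 (κ z) (prodMargins (κ z))) π
  swap
  · rw [integral_undef hint]; exact hrhs
  have sae : ∀ z ∈ unitI, ∀ᵐ x ∂(κ z), x ∈ unitSq := fun z hz =>
    (mem_ae_iff_prob_eq_one measurableSet_unitSq).2 (ks z hz)
  have key : ∀ m, ∀ z ∈ C m, W2 (κ z) (prodMargins (κ z)) ≤
      W2 (condBin p κ (C m)) (prodMargins (condBin p κ (C m))) + 3 * √(L * D) := by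
    intro m z hz
    have hm0 : π (C m) ≠ 0 := (hCpos m).ne'
    have e : condBin p κ (C m) = mixt π κ (C m) := rfl
    rw [e]
    have hs : ∀ z ∈ C m, κ z unitSq = 1 := fun z hz => ks z (hCI m hz)
    have := mixt_prob kM kp hm0
    have h1 := W2_prodMargins_le (sae z (hCI m hz)) (mixt_ae kM kp (hCm m) hm0 hs)
    have h2 : W2 (κ z) (mixt π κ (C m)) ≤ √(2 * (L * D)) := by
      refine W2_mixt_le kM kp (hCm m) hm0 hs hz (Real.sqrt_nonneg _) fun z' hz' => ?_
      refine W2_le_of_W1 (sae z (hCI m hz)) (sae z' (hCI m hz')) ?_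
      refine (hL z (hCI m hz) z' (hCI m hz')).trans (mul_le_mul_of_nonneg_left ?_ hL0)
      rw [← Real.dist_eq]
      refine (Metric.dist_le_diam_of_mem ((Metric.isBounded_Icc 0 1).subset (hCI m)) hz hz').trans ?_
      exact le_ciSup (f := fun m => Metric.diam (C m)) (Set.finite_range _).bddAbove m
    have h3 : 2 * √(2 * (L * D)) ≤ 3 * √(L * D) := by
      rw [Real.sqrt_mul (by norm_num), ← mul_assoc]
      refine mul_le_mul_of_nonneg_right ?_ (Real.sqrt_nonneg _)
      have : √2 ≤ 3 / 2 := by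
        rw [Real.sqrt_le_left (by norm_num)]; norm_num
      linarith
    linarith
  have hres : π.restrict (⋃ m, C m) = π := by
    rw [hCu]
    exact Measure.restrict_eq_self_of_ae_mem ((mem_ae_iff_prob_eq_one measurableSet_Icc).2 hπI)
  have hCd' : Pairwise (Function.onFun Disjoint C) := fun i j hij =>
    hCd (Set.mem_univ i) (Set.mem_univ j) hij
  have hsum : ∑ m, (π (C m)).toReal = 1 := by
    rw [← ENNReal.toReal_sum fun i _ => measure_ne_top _ _, ← tsum_fintype (L := .unconditional _),
      ← measure_iUnion hCd' hCm, hCu, hπI, ENNReal.toReal_one]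
  calc ∫ z, W2 (κ z) (prodMargins (κ z)) ∂π
      = ∑ m, ∫ z in C m, W2 (κ z) (prodMargins (κ z)) ∂π := by
        rw [← integral_iUnion_fintype hCm hCd' (fun m => hint.integrableOn), hres]
    _ ≤ ∑ m, (W2 (condBin p κ (C m)) (prodMargins (condBin p κ (C m))) + 3 * √(L * D)) *
          (π (C m)).toReal := by
        refine Finset.sum_le_sum fun m _ => ?_
        refine (setIntegral_mono_on hint.integrableOn (integrable_const _).integrableOn (hCm m)
          (key m)).trans (le_of_eq ?_)
        rw [setIntegral_const, smul_eq_mul, mul_comm]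
        rfl
    _ = _ := by
        simp_rw [add_mul]
        rw [Finset.sum_add_distrib, ← Finset.mul_sum, hsum, mul_one]

end
end
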